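/- arXiv:cs/0611029 — 3 statements merged into one kernel-verified Lean document; each statement's English description precedes it below -/
import Mathlib

section
/- Given a finite Kripke structure M and a PLTL formula ψ, if the incremental PLTL eventuality encoding ⟦M,¬ψ,k⟧ is satisfiable for some k, then ⟦M,¬ψ,k'⟧ is satisfiable for all k' ≥ k. -/
namespace BMC

/-- PLTL formulas in positive normal form: literals `p`, `¬p`, conjunction,
disjunction, next `X`, until `U`, release `R`, previous `Y`, weak previous `Z`,
since `S` and trigger `T`. -/
inductive PLTL (AP : Type) : Type
  | atom  : AP → PLTL AP
  | natom : AP → PLTL AP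
  | conj  : PLTL AP → PLTL AP → PLTL AP
  | disj  : PLTL AP → PLTL AP → PLTL AP
  | next  : PLTL AP → PLTL AP
  | untl  : PLTL AP → PLTL AP → PLTL AP
  | rels  : PLTL AP → PLTL AP → PLTL AP
  | prev  : PLTL AP → PLTL AP
  | wprev : PLTL AP → PLTL AP
  | since : PLTL AP → PLTL AP → PLTL AP
  | trig  : PLTL AP → PLTL AP → PLTL AP

variable {AP S : Type}

/-- Standard PLTL semantics `π^i ⊨ φ` on an infinite sequence of states `π`
with labelling `L`. -/
def PLTL.sat (L : S → Set AP) (π : ℕ → S) : PLTL AP → ℕ → Prop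
  | .atom p, i => p ∈ L (π i)
  | .natom p, i => p ∉ L (π i)
  | .conj f g, i => PLTL.sat L π f i ∧ PLTL.sat L π g i
  | .disj f g, i => PLTL.sat L π f i ∨ PLTL.sat L π g i
  | .next f, i => PLTL.sat L π f (i + 1)
  | .untl f g, i => ∃ j, i ≤ j ∧ PLTL.sat L π g j ∧ ∀ n, i ≤ n → n < j → PLTL.sat L π f n
  | .rels f g, i => ∀ j, i ≤ j → (PLTL.sat L π g j ∨ ∃ n, i ≤ n ∧ n < j ∧ PLTL.sat L π f n)
  | .prev f, i => 0 < i ∧ PLTL.sat L π f (i - 1)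
  | .wprev f, i => i = 0 ∨ PLTL.sat L π f (i - 1)
  | .since f g, i => ∃ j, j ≤ i ∧ PLTL.sat L π g j ∧ ∀ n, j < n → n ≤ i → PLTL.sat L π f n
  | .trig f g, i => ∀ j, j ≤ i → (PLTL.sat L π g j ∨ ∃ n, j < n ∧ n ≤ i ∧ PLTL.sat L π f n)

/-- The no-loop bounded semantics `π^i ⊨_nl φ` with bound `k`: future operators
are restricted to positions `≤ k`. -/
def PLTL.satNL (L : S → Set AP) (π : ℕ → S) (k : ℕ) : PLTL AP → ℕ → Prop
  | .atom p, i => p ∈ L (π i)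
  | .natom p, i => p ∉ L (π i)
  | .conj f g, i => PLTL.satNL L π k f i ∧ PLTL.satNL L π k g i
  | .disj f g, i => PLTL.satNL L π k f i ∨ PLTL.satNL L π k g i
  | .next f, i => i < k ∧ PLTL.satNL L π k f (i + 1)
  | .untl f g, i => ∃ j, i ≤ j ∧ j ≤ k ∧ PLTL.satNL L π k g j ∧
      ∀ n, i ≤ n → n < j → PLTL.satNL L π k f n
  | .rels f g, i => ∃ j, i ≤ j ∧ j ≤ k ∧ PLTL.satNL L π k f j ∧
      ∀ n, i ≤ n → n ≤ j → PLTL.satNL L π k g n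
  | .prev f, i => 0 < i ∧ PLTL.satNL L π k f (i - 1)
  | .wprev f, i => i = 0 ∨ PLTL.satNL L π k f (i - 1)
  | .since f g, i => ∃ j, j ≤ i ∧ PLTL.satNL L π k g j ∧
      ∀ n, j < n → n ≤ i → PLTL.satNL L π k f n
  | .trig f g, i => ∀ j, j ≤ i → (PLTL.satNL L π k g j ∨
      ∃ n, j < n ∧ n ≤ i ∧ PLTL.satNL L π k f n)

/-- `π` is a (k,l)-loop: `0 < l ≤ k`, `π (l-1) = π k`, and from position `l`
onwards `π` is periodic with period `p = k + 1 - l`. -/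
def IsKLoop (π : ℕ → S) (k l : ℕ) : Prop :=
  0 < l ∧ l ≤ k ∧ π (l - 1) = π k ∧ ∀ i, l ≤ i → π (i + (k + 1 - l)) = π i

/-- The bounded semantics `π ⊨_k φ`. -/
def PLTL.bsat (L : S → Set AP) (π : ℕ → S) (k : ℕ) (φ : PLTL AP) : Prop :=
  (∃ l, IsKLoop π k l ∧ PLTL.sat L π φ 0) ∨ PLTL.satNL L π k φ 0

/-- The past operator depth `δ`. -/
def PLTL.delta : PLTL AP → ℕ
  | .atom _ => 0
  | .natom _ => 0
  | .conj f g => max f.delta g.delta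
  | .disj f g => max f.delta g.delta
  | .next f => f.delta
  | .untl f g => max f.delta g.delta
  | .rels f g => max f.delta g.delta
  | .prev f => f.delta + 1
  | .wprev f => f.delta + 1
  | .since f g => max f.delta g.delta + 1
  | .trig f g => max f.delta g.delta + 1

/-- A Kripke structure over state space `S` and atomic propositions `AP`. -/
structure Kripke (S AP : Type) where
  T : S → S → Prop
  I : S → Prop
  L : S → Set AP

/-- The transition relation is total. -/
def Kripke.Total (M : Kripke S AP) : Prop := ∀ s, ∃ s', M.T s s'

/-- An initialised infinite path of `M`. -/
def Kripke.InitPath (M : Kripke S AP) (π : ℕ → S) : Prop :=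
  M.I (π 0) ∧ ∀ i, M.T (π i) (π (i + 1))

end BMC
namespace BMC

variable {AP S : Type}

/-- Model constraints `⟦M⟧_k = I(s_0) ∧ ⋀_{i=1}^k T(s_{i-1}, s_i)`. -/
def ModelC (M : Kripke S AP) (k : ℕ) (s : ℕ → S) : Prop :=
  M.I (s 0) ∧ ∀ i, 1 ≤ i → i ≤ k → M.T (s (i - 1)) (s i)

/-- Loop constraints `⟦LoopConstraints⟧_k`. -/
def LoopC (k : ℕ) (s : ℕ → S) (lsel inL : ℕ → Prop) (LE : Prop) : Prop :=
  ¬ lsel 0 ∧ ¬ inL 0 ∧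
  (∀ i, 1 ≤ i → i ≤ k → (lsel i → s (i - 1) = s k)) ∧
  (∀ i, 1 ≤ i → i ≤ k → (inL i ↔ (inL (i - 1) ∨ lsel i))) ∧
  (∀ i, 1 ≤ i → i ≤ k → (inL (i - 1) → ¬ lsel i)) ∧
  (LE ↔ inL k)

end BMC
namespace BMC

variable {AP S : Type}

/-- Lookup of the virtually unrolled formula variable `⟦φ⟧^d_i`, using the
convention `⟦φ⟧^d_i = ⟦φ⟧^{δ(φ)}_i` when `d > δ(φ)`. -/
def pV (v : PLTL AP → ℕ → ℕ → Prop) (φ : PLTL AP) (d i : ℕ) : Prop :=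
  v φ (min d φ.delta) i

/-- `⟦LastStateFormula⟧_k` constraints for one subformula `φ` of the PLTL
eventuality encoding. -/
def pLastC (k : ℕ) (lsel : ℕ → Prop) (LE : Prop)
    (v : PLTL AP → ℕ → ℕ → Prop) (φ : PLTL AP) : Prop :=
  ∀ d, d ≤ φ.delta →
    (¬ LE → ¬ v φ d (k + 1)) ∧
    (∀ i, 1 ≤ i → i ≤ k → lsel i → (v φ d (k + 1) ↔ pV v φ (d + 1) i))

/-- The constraints `⟦EventualityPLTL⟧_k` (together with the
`⟦LastStateFormula⟧_k` constraints) of the PLTL eventuality encoding,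
generated for a formula and, recursively, all of its subformulas.
`v φ d i` is the formula variable `⟦φ⟧^d_i` and `aux φ i` the auxiliary
variable `⟨⟨Fψ2⟩⟩^{δ(ψ2)}_i` (for until subformulas `φ = ψ1 U ψ2`)
resp. `⟨⟨Gψ2⟩⟩^{δ(ψ2)}_i` (for release subformulas). -/
def pevC (k : ℕ) (L : S → Set AP) (s : ℕ → S) (lsel inL : ℕ → Prop)
    (LE : Prop) (v : PLTL AP → ℕ → ℕ → Prop) (aux : PLTL AP → ℕ → Prop) :
    PLTL AP → Prop
  | .atom p =>
      (∀ i, i ≤ k → (v (.atom p) 0 i ↔ p ∈ L (s i))) ∧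
      pLastC k lsel LE v (.atom p)
  | .natom p =>
      (∀ i, i ≤ k → (v (.natom p) 0 i ↔ p ∉ L (s i))) ∧
      pLastC k lsel LE v (.natom p)
  | .conj f g =>
      pevC k L s lsel inL LE v aux f ∧ pevC k L s lsel inL LE v aux g ∧
      (∀ d, d ≤ (PLTL.conj f g).delta → ∀ i, i ≤ k →
        (v (.conj f g) d i ↔ (pV v f d i ∧ pV v g d i))) ∧
      pLastC k lsel LE v (.conj f g)
  | .disj f g =>
      pevC k L s lsel inL LE v aux f ∧ pevC k L s lsel inL LE v aux g ∧
      (∀ d, d ≤ (PLTL.disj f g).delta → ∀ i, i ≤ k →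
        (v (.disj f g) d i ↔ (pV v f d i ∨ pV v g d i))) ∧
      pLastC k lsel LE v (.disj f g)
  | .next f =>
      pevC k L s lsel inL LE v aux f ∧
      (∀ d, d ≤ (PLTL.next f).delta → ∀ i, i ≤ k →
        (v (.next f) d i ↔ pV v f d (i + 1))) ∧
      pLastC k lsel LE v (.next f)
  | .untl f g =>
      pevC k L s lsel inL LE v aux f ∧ pevC k L s lsel inL LE v aux g ∧
      (∀ d, d ≤ (PLTL.untl f g).delta → ∀ i, i ≤ k →
        (v (.untl f g) d i ↔
          (pV v g d i ∨ (pV v f d i ∧ v (.untl f g) d (i + 1))))) ∧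
      pLastC k lsel LE v (.untl f g) ∧
      (¬ aux (.untl f g) 0) ∧
      (∀ i, 1 ≤ i → i ≤ k →
        (aux (.untl f g) i ↔
          (aux (.untl f g) (i - 1) ∨ (inL i ∧ v g g.delta i)))) ∧
      (LE → v (.untl f g) (PLTL.untl f g).delta k → aux (.untl f g) k)
  | .rels f g =>
      pevC k L s lsel inL LE v aux f ∧ pevC k L s lsel inL LE v aux g ∧
      (∀ d, d ≤ (PLTL.rels f g).delta → ∀ i, i ≤ k →
        (v (.rels f g) d i ↔
          (pV v g d i ∧ (pV v f d i ∨ v (.rels f g) d (i + 1))))) ∧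
      pLastC k lsel LE v (.rels f g) ∧
      (aux (.rels f g) 0) ∧
      (∀ i, 1 ≤ i → i ≤ k →
        (aux (.rels f g) i ↔
          (aux (.rels f g) (i - 1) ∧ (¬ inL i ∨ v g g.delta i)))) ∧
      (LE → aux (.rels f g) k → v (.rels f g) (PLTL.rels f g).delta k)
  | .prev f =>
      pevC k L s lsel inL LE v aux f ∧
      (∀ d, d ≤ (PLTL.prev f).delta → ¬ v (.prev f) d 0) ∧
      (∀ i, 1 ≤ i → i ≤ k → (v (.prev f) 0 i ↔ pV v f 0 (i - 1))) ∧
      (∀ d, 1 ≤ d → d ≤ (PLTL.prev f).delta → ∀ i, 1 ≤ i → i ≤ k →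
        (v (.prev f) d i ↔
          ((lsel i ∧ pV v f (d - 1) k) ∨ (¬ lsel i ∧ pV v f d (i - 1))))) ∧
      pLastC k lsel LE v (.prev f)
  | .wprev f =>
      pevC k L s lsel inL LE v aux f ∧
      (∀ d, d ≤ (PLTL.wprev f).delta → v (.wprev f) d 0) ∧
      (∀ i, 1 ≤ i → i ≤ k → (v (.wprev f) 0 i ↔ pV v f 0 (i - 1))) ∧
      (∀ d, 1 ≤ d → d ≤ (PLTL.wprev f).delta → ∀ i, 1 ≤ i → i ≤ k →
        (v (.wprev f) d i ↔
          ((lsel i ∧ pV v f (d - 1) k) ∨ (¬ lsel i ∧ pV v f d (i - 1))))) ∧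
      pLastC k lsel LE v (.wprev f)
  | .since f g =>
      pevC k L s lsel inL LE v aux f ∧ pevC k L s lsel inL LE v aux g ∧
      (∀ d, d ≤ (PLTL.since f g).delta → (v (.since f g) d 0 ↔ pV v g d 0)) ∧
      (∀ i, 1 ≤ i → i ≤ k →
        (v (.since f g) 0 i ↔
          (pV v g 0 i ∨ (pV v f 0 i ∧ v (.since f g) 0 (i - 1))))) ∧
      (∀ d, 1 ≤ d → d ≤ (PLTL.since f g).delta → ∀ i, 1 ≤ i → i ≤ k →
        (v (.since f g) d i ↔
          (pV v g d i ∨ (pV v f d i ∧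
            ((lsel i ∧ v (.since f g) (d - 1) k) ∨
             (¬ lsel i ∧ v (.since f g) d (i - 1))))))) ∧
      pLastC k lsel LE v (.since f g)
  | .trig f g =>
      pevC k L s lsel inL LE v aux f ∧ pevC k L s lsel inL LE v aux g ∧
      (∀ d, d ≤ (PLTL.trig f g).delta → (v (.trig f g) d 0 ↔ pV v g d 0)) ∧
      (∀ i, 1 ≤ i → i ≤ k →
        (v (.trig f g) 0 i ↔
          (pV v g 0 i ∧ (pV v f 0 i ∨ v (.trig f g) 0 (i - 1))))) ∧
      (∀ d, 1 ≤ d → d ≤ (PLTL.trig f g).delta → ∀ i, 1 ≤ i → i ≤ k →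
        (v (.trig f g) d i ↔
          (pV v g d i ∧ (pV v f d i ∨
            ((lsel i ∧ v (.trig f g) (d - 1) k) ∨
             (¬ lsel i ∧ v (.trig f g) d (i - 1))))))) ∧
      pLastC k lsel LE v (.trig f g)

/-- Satisfiability of the PLTL eventuality encoding
`⟦M,ψ,k⟧ = ⟦M⟧_k ∧ ⟦LoopConstraints⟧_k ∧ ⟦LastStateFormula⟧_k ∧
⟦EventualityPLTL⟧_k ∧ ⟦ψ⟧^0_0`. -/
def PEvSat (M : Kripke S AP) (ψ : PLTL AP) (k : ℕ) : Prop :=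
  ∃ (s : ℕ → S) (lsel inL : ℕ → Prop) (LE : Prop)
    (v : PLTL AP → ℕ → ℕ → Prop) (aux : PLTL AP → ℕ → Prop),
    ModelC M k s ∧ LoopC k s lsel inL LE ∧
    pevC k M.L s lsel inL LE v aux ψ ∧ v ψ 0 0

end BMC
namespace BMC

variable {AP S : Type}

/-- Lookup of a proxy formula variable (at index `E` or `L`) with the
convention that unrollings beyond `δ(φ)` are identified with `δ(φ)`. -/
def pW (w : PLTL AP → ℕ → Prop) (φ : PLTL AP) (d : ℕ) : Prop :=
  w φ (min d φ.delta)

/-- Loop constraints of the incremental PLTL eventuality encoding, using the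
proxy state `sE`; the flag `dep` controls whether the `k`-dependent
constraints (`s_E = s_k` and `LoopExists ⇔ InLoop_k`) are included. -/
def incLoopC (dep : Bool) (k : ℕ) (s : ℕ → S) (sE : S)
    (lsel inL : ℕ → Prop) (LE : Prop) : Prop :=
  ¬ lsel 0 ∧ ¬ inL 0 ∧
  (∀ i, 1 ≤ i → i ≤ k → (lsel i → s (i - 1) = sE)) ∧
  (∀ i, 1 ≤ i → i ≤ k → (inL i ↔ (inL (i - 1) ∨ lsel i))) ∧
  (∀ i, 1 ≤ i → i ≤ k → (inL (i - 1) → ¬ lsel i)) ∧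
  (dep = true → (LE ↔ inL k)) ∧
  (dep = true → sE = s k)

/-- The `⟦LastStateFormula⟧_k` constraints of the incremental encoding for one
subformula `φ`, with proxy variables `⟦φ⟧^d_L` and `⟦φ⟧^d_E`; the flag `dep`
controls the `k`-dependent constraints `⟦φ⟧^d_E ⇔ ⟦φ⟧^d_k` and
`⟦φ⟧^d_{k+1} ⇔ ⟦φ⟧^{min(d+1,δ(φ))}_L`. -/
def incLastC (dep : Bool) (k : ℕ) (lsel : ℕ → Prop) (LE : Prop)
    (v : PLTL AP → ℕ → ℕ → Prop) (vE vL : PLTL AP → ℕ → Prop)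
    (φ : PLTL AP) : Prop :=
  ∀ d, d ≤ φ.delta →
    (¬ LE → ¬ vL φ d) ∧
    (∀ i, 1 ≤ i → i ≤ k → lsel i → (vL φ d ↔ v φ d i)) ∧
    (dep = true → (vE φ d ↔ v φ d k)) ∧
    (dep = true → (v φ d (k + 1) ↔ pW vL φ (d + 1)))

/-- The constraints `⟦IncPLTL⟧_k` (together with `⟦LastStateFormula⟧_k`) of
the incremental PLTL eventuality encoding, generated recursively for all
subformulas.  `v φ d i` are the formula variables, `vE`/`vL` the proxy
variables at the proxy indices `E` resp. `L`, `aux φ i` the auxiliary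
variables and `auxE φ` their proxies at index `E`; the flag `dep` controls
whether the `k`-dependent constraints are included. -/
def pincC (dep : Bool) (k : ℕ) (L : S → Set AP) (s : ℕ → S)
    (lsel inL : ℕ → Prop) (LE : Prop) (v : PLTL AP → ℕ → ℕ → Prop)
    (vE vL : PLTL AP → ℕ → Prop) (aux : PLTL AP → ℕ → Prop)
    (auxE : PLTL AP → Prop) : PLTL AP → Prop
  | .atom p =>
      (∀ i, i ≤ k → (v (.atom p) 0 i ↔ p ∈ L (s i))) ∧
      incLastC dep k lsel LE v vE vL (.atom p)
  | .natom p =>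
      (∀ i, i ≤ k → (v (.natom p) 0 i ↔ p ∉ L (s i))) ∧
      incLastC dep k lsel LE v vE vL (.natom p)
  | .conj f g =>
      pincC dep k L s lsel inL LE v vE vL aux auxE f ∧
      pincC dep k L s lsel inL LE v vE vL aux auxE g ∧
      (∀ d, d ≤ (PLTL.conj f g).delta → ∀ i, i ≤ k →
        (v (.conj f g) d i ↔ (pV v f d i ∧ pV v g d i))) ∧
      incLastC dep k lsel LE v vE vL (.conj f g)
  | .disj f g =>
      pincC dep k L s lsel inL LE v vE vL aux auxE f ∧
      pincC dep k L s lsel inL LE v vE vL aux auxE g ∧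
      (∀ d, d ≤ (PLTL.disj f g).delta → ∀ i, i ≤ k →
        (v (.disj f g) d i ↔ (pV v f d i ∨ pV v g d i))) ∧
      incLastC dep k lsel LE v vE vL (.disj f g)
  | .next f =>
      pincC dep k L s lsel inL LE v vE vL aux auxE f ∧
      (∀ d, d ≤ (PLTL.next f).delta → ∀ i, i ≤ k →
        (v (.next f) d i ↔ pV v f d (i + 1))) ∧
      incLastC dep k lsel LE v vE vL (.next f)
  | .untl f g =>
      pincC dep k L s lsel inL LE v vE vL aux auxE f ∧
      pincC dep k L s lsel inL LE v vE vL aux auxE g ∧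
      (∀ d, d ≤ (PLTL.untl f g).delta → ∀ i, i ≤ k →
        (v (.untl f g) d i ↔
          (pV v g d i ∨ (pV v f d i ∧ v (.untl f g) d (i + 1))))) ∧
      incLastC dep k lsel LE v vE vL (.untl f g) ∧
      (¬ aux (.untl f g) 0) ∧
      (∀ i, 1 ≤ i → i ≤ k →
        (aux (.untl f g) i ↔
          (aux (.untl f g) (i - 1) ∨ (inL i ∧ v g g.delta i)))) ∧
      (LE → vE (.untl f g) (PLTL.untl f g).delta → auxE (.untl f g)) ∧
      (dep = true → (auxE (.untl f g) ↔ aux (.untl f g) k))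
  | .rels f g =>
      pincC dep k L s lsel inL LE v vE vL aux auxE f ∧
      pincC dep k L s lsel inL LE v vE vL aux auxE g ∧
      (∀ d, d ≤ (PLTL.rels f g).delta → ∀ i, i ≤ k →
        (v (.rels f g) d i ↔
          (pV v g d i ∧ (pV v f d i ∨ v (.rels f g) d (i + 1))))) ∧
      incLastC dep k lsel LE v vE vL (.rels f g) ∧
      (aux (.rels f g) 0) ∧
      (∀ i, 1 ≤ i → i ≤ k →
        (aux (.rels f g) i ↔
          (aux (.rels f g) (i - 1) ∧ (¬ inL i ∨ v g g.delta i)))) ∧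
      (LE → auxE (.rels f g) → vE (.rels f g) (PLTL.rels f g).delta) ∧
      (dep = true → (auxE (.rels f g) ↔ aux (.rels f g) k))
  | .prev f =>
      pincC dep k L s lsel inL LE v vE vL aux auxE f ∧
      (∀ d, d ≤ (PLTL.prev f).delta → ¬ v (.prev f) d 0) ∧
      (∀ i, 1 ≤ i → i ≤ k → (v (.prev f) 0 i ↔ pV v f 0 (i - 1))) ∧
      (∀ d, 1 ≤ d → d ≤ (PLTL.prev f).delta → ∀ i, 1 ≤ i → i ≤ k →
        (v (.prev f) d i ↔
          ((lsel i ∧ pW vE f (d - 1)) ∨ (¬ lsel i ∧ pV v f d (i - 1))))) ∧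
      incLastC dep k lsel LE v vE vL (.prev f)
  | .wprev f =>
      pincC dep k L s lsel inL LE v vE vL aux auxE f ∧
      (∀ d, d ≤ (PLTL.wprev f).delta → v (.wprev f) d 0) ∧
      (∀ i, 1 ≤ i → i ≤ k → (v (.wprev f) 0 i ↔ pV v f 0 (i - 1))) ∧
      (∀ d, 1 ≤ d → d ≤ (PLTL.wprev f).delta → ∀ i, 1 ≤ i → i ≤ k →
        (v (.wprev f) d i ↔
          ((lsel i ∧ pW vE f (d - 1)) ∨ (¬ lsel i ∧ pV v f d (i - 1))))) ∧
      incLastC dep k lsel LE v vE vL (.wprev f)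
  | .since f g =>
      pincC dep k L s lsel inL LE v vE vL aux auxE f ∧
      pincC dep k L s lsel inL LE v vE vL aux auxE g ∧
      (∀ d, d ≤ (PLTL.since f g).delta → (v (.since f g) d 0 ↔ pV v g d 0)) ∧
      (∀ i, 1 ≤ i → i ≤ k →
        (v (.since f g) 0 i ↔
          (pV v g 0 i ∨ (pV v f 0 i ∧ v (.since f g) 0 (i - 1))))) ∧
      (∀ d, 1 ≤ d → d ≤ (PLTL.since f g).delta → ∀ i, 1 ≤ i → i ≤ k →
        (v (.since f g) d i ↔
          (pV v g d i ∨ (pV v f d i ∧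
            ((lsel i ∧ vE (.since f g) (d - 1)) ∨
             (¬ lsel i ∧ v (.since f g) d (i - 1))))))) ∧
      incLastC dep k lsel LE v vE vL (.since f g)
  | .trig f g =>
      pincC dep k L s lsel inL LE v vE vL aux auxE f ∧
      pincC dep k L s lsel inL LE v vE vL aux auxE g ∧
      (∀ d, d ≤ (PLTL.trig f g).delta → (v (.trig f g) d 0 ↔ pV v g d 0)) ∧
      (∀ i, 1 ≤ i → i ≤ k →
        (v (.trig f g) 0 i ↔
          (pV v g 0 i ∧ (pV v f 0 i ∨ v (.trig f g) 0 (i - 1))))) ∧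
      (∀ d, 1 ≤ d → d ≤ (PLTL.trig f g).delta → ∀ i, 1 ≤ i → i ≤ k →
        (v (.trig f g) d i ↔
          (pV v g d i ∧ (pV v f d i ∨
            ((lsel i ∧ vE (.trig f g) (d - 1)) ∨
             (¬ lsel i ∧ v (.trig f g) d (i - 1))))))) ∧
      incLastC dep k lsel LE v vE vL (.trig f g)

/-- Satisfiability of the incremental PLTL eventuality encoding
`⟦M,ψ,k⟧ = ⟦M⟧_k ∧ ⟦LoopConstraints⟧_k ∧ ⟦LastStateFormula⟧_k ∧
⟦IncPLTL⟧_k ∧ ⟦ψ⟧^0_0` (the witness formula). -/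
def IncSat (M : Kripke S AP) (ψ : PLTL AP) (k : ℕ) : Prop :=
  ∃ (s : ℕ → S) (sE : S) (lsel inL : ℕ → Prop) (LE : Prop)
    (v : PLTL AP → ℕ → ℕ → Prop) (vE vL : PLTL AP → ℕ → Prop)
    (aux : PLTL AP → ℕ → Prop) (auxE : PLTL AP → Prop),
    ModelC M k s ∧ incLoopC true k s sE lsel inL LE ∧
    pincC true k M.L s lsel inL LE v vE vL aux auxE ψ ∧ v ψ 0 0

end BMC
namespace BMC

variable {AP S : Type}

/-- Negation of a PNF formula, via the standard dualities. -/
def PLTL.neg : PLTL AP → PLTL AP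
  | .atom p => .natom p
  | .natom p => .atom p
  | .conj f g => .disj f.neg g.neg
  | .disj f g => .conj f.neg g.neg
  | .next f => .next f.neg
  | .untl f g => .rels f.neg g.neg
  | .rels f g => .untl f.neg g.neg
  | .prev f => .wprev f.neg
  | .wprev f => .prev f.neg
  | .since f g => .trig f.neg g.neg
  | .trig f g => .since f.neg g.neg

/-- The list of subformulas of a PLTL formula. -/
def PLTL.subfs : PLTL AP → List (PLTL AP)
  | .atom p => [.atom p]
  | .natom p => [.natom p]
  | .conj f g => .conj f g :: (f.subfs ++ g.subfs)
  | .disj f g => .disj f g :: (f.subfs ++ g.subfs)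
  | .next f => .next f :: f.subfs
  | .untl f g => .untl f g :: (f.subfs ++ g.subfs)
  | .rels f g => .rels f g :: (f.subfs ++ g.subfs)
  | .prev f => .prev f :: f.subfs
  | .wprev f => .wprev f :: f.subfs
  | .since f g => .since f g :: (f.subfs ++ g.subfs)
  | .trig f g => .trig f g :: (f.subfs ++ g.subfs)

/-- `φ` is an until or release formula (so that it carries auxiliary
variables in the encoding). -/
def PLTL.isUR : PLTL AP → Prop
  | .untl _ _ => True
  | .rels _ _ => True
  | _ => False

/-- The simple path formula `⟦SimplePath⟧_k` for the incremental encoding of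
the formula `χ`: any two distinct positions `i < j ≤ k` differ in the system
state, in `InLoop`, in the formula variables at unrolling `0`, or (when both
are in the loop) in the full vectors of formula variables or of auxiliary
variables. -/
def SimplePathC (χ : PLTL AP) (k : ℕ) (s : ℕ → S) (inL : ℕ → Prop)
    (v : PLTL AP → ℕ → ℕ → Prop) (aux : PLTL AP → ℕ → Prop) : Prop :=
  ∀ i j, i < j → j ≤ k →
    (s i ≠ s j ∨
     ¬ (inL i ↔ inL j) ∨
     (∃ φ ∈ χ.subfs, ¬ (v φ 0 i ↔ v φ 0 j)) ∨
     (inL i ∧ inL j ∧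
       ((∃ φ ∈ χ.subfs, ∃ d, d ≤ PLTL.delta φ ∧ ¬ (v φ d i ↔ v φ d j)) ∨
        (∃ φ ∈ χ.subfs, φ.isUR ∧ ¬ (aux φ i ↔ aux φ j)))))

/-- Satisfiability of the witness formula `⟦M,χ,k⟧` conjoined with the simple
path formula `⟦SimplePath⟧_k`. -/
def WitSPSat (M : Kripke S AP) (χ : PLTL AP) (k : ℕ) : Prop :=
  ∃ (s : ℕ → S) (sE : S) (lsel inL : ℕ → Prop) (LE : Prop)
    (v : PLTL AP → ℕ → ℕ → Prop) (vE vL : PLTL AP → ℕ → Prop)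
    (aux : PLTL AP → ℕ → Prop) (auxE : PLTL AP → Prop),
    ModelC M k s ∧ incLoopC true k s sE lsel inL LE ∧
    pincC true k M.L s lsel inL LE v vE vL aux auxE χ ∧ v χ 0 0 ∧
    SimplePathC χ k s inL v aux

/-- Satisfiability of the completeness formula `⟦⟦M,χ,k⟧⟧` (the witness
formula with all `k`-dependent constraints removed) conjoined with the simple
path formula `⟦SimplePath⟧_k`. -/
def ComplSPSat (M : Kripke S AP) (χ : PLTL AP) (k : ℕ) : Prop :=
  ∃ (s : ℕ → S) (sE : S) (lsel inL : ℕ → Prop) (LE : Prop)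
    (v : PLTL AP → ℕ → ℕ → Prop) (vE vL : PLTL AP → ℕ → Prop)
    (aux : PLTL AP → ℕ → Prop) (auxE : PLTL AP → Prop),
    ModelC M k s ∧ incLoopC false k s sE lsel inL LE ∧
    pincC false k M.L s lsel inL LE v vE vL aux auxE χ ∧ v χ 0 0 ∧
    SimplePathC χ k s inL v aux

/-- `M ⊨ ψ`: every initialised infinite path of `M` satisfies `ψ`. -/
def Kripke.Models (M : Kripke S AP) (ψ : PLTL AP) : Prop :=
  ∀ π : ℕ → S, M.InitPath π → PLTL.sat M.L π ψ 0

end BMC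
namespace BMC

variable {AP S : Type}

theorem pinc_last {dep : Bool} {k : ℕ} {L : S → Set AP} {s : ℕ → S} {lsel inL : ℕ → Prop}
    {LE : Prop} {v : PLTL AP → ℕ → ℕ → Prop} {vE vL : PLTL AP → ℕ → Prop}
    {aux : PLTL AP → ℕ → Prop} {auxE : PLTL AP → Prop} {φ : PLTL AP}
    (h : pincC dep k L s lsel inL LE v vE vL aux auxE φ) :
    incLastC dep k lsel LE v vE vL φ := by
  cases φ with
  | atom p => exact h.2
  | natom p => exact h.2
  | conj f g => exact h.2.2.2
  | disj f g => exact h.2.2.2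
  | next f => exact h.2.2
  | untl f g => exact h.2.2.2.1
  | rels f g => exact h.2.2.2.1
  | prev f => exact h.2.2.2.2
  | wprev f => exact h.2.2.2.2
  | since f g => exact h.2.2.2.2.2
  | trig f g => exact h.2.2.2.2.2

/-! ### no-loop case -/

def auxN : PLTL AP → ℕ → Prop
  | .rels _ _, _ => True
  | _, _ => False

theorem nl_sound (k : ℕ) (L : S → Set AP) (s s' : ℕ → S) (lsel inL : ℕ → Prop) (LE : Prop)
    (v : PLTL AP → ℕ → ℕ → Prop) (vE vL : PLTL AP → ℕ → Prop) (aux : PLTL AP → ℕ → Prop)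
    (auxE : PLTL AP → Prop) (hLE : ¬ LE) (hls : ∀ i, 1 ≤ i → i ≤ k → ¬ lsel i)
    (hs : ∀ i, i ≤ k → s' i = s i)
    (hend : ∀ φ : PLTL AP, incLastC true k lsel LE v vE vL φ → ∀ d, d ≤ φ.delta → ¬ v φ d (k+1))
    (φ : PLTL AP) :
    pincC true k L s lsel inL LE v vE vL aux auxE φ →
    ∀ d, d ≤ φ.delta → ∀ i, i ≤ k → v φ d i → PLTL.satNL L s' (k+1) φ i := by
  induction φ with
  | atom p =>
    rintro ⟨h, -⟩ d hd i hi hv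
    obtain rfl : d = 0 := by simpa [PLTL.delta] using hd
    simpa [PLTL.satNL, hs i hi] using (h i hi).1 hv
  | natom p =>
    rintro ⟨h, -⟩ d hd i hi hv
    obtain rfl : d = 0 := by simpa [PLTL.delta] using hd
    simpa [PLTL.satNL, hs i hi] using (h i hi).1 hv
  | conj f g ihf ihg =>
    rintro ⟨hf, hg, h, -⟩ d hd i hi hv
    obtain ⟨h1, h2⟩ := (h d hd i hi).1 hv
    exact ⟨ihf hf _ (min_le_right _ _) i hi h1, ihg hg _ (min_le_right _ _) i hi h2⟩
  | disj f g ihf ihg =>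
    rintro ⟨hf, hg, h, -⟩ d hd i hi hv
    rcases (h d hd i hi).1 hv with h1 | h1
    · exact Or.inl (ihf hf _ (min_le_right _ _) i hi h1)
    · exact Or.inr (ihg hg _ (min_le_right _ _) i hi h1)
  | next f ihf =>
    rintro ⟨hf, h, hl⟩ d hd i hi hv
    have hv' := hv
    rw [h d hd i hi] at hv
    have hfl : ∀ d, d ≤ f.delta → ¬ v f d (k+1) := hend _ (pinc_last hf)
    rcases Nat.lt_or_ge i k with hik | hik
    · exact ⟨by omega, ihf hf _ (min_le_right _ _) _ hik hv⟩
    · obtain rfl : i = k := by omega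
      exact absurd hv (hfl _ (min_le_right _ _))
  | untl f g ihf ihg =>
    rintro ⟨hf, hg, h, hl, -⟩ d hd i hi hv
    obtain ⟨m, hm⟩ : ∃ m, m = k - i := ⟨_, rfl⟩
    induction m generalizing i with
    | zero =>
      obtain rfl : i = k := by omega
      rcases (h d hd i hi).1 hv with h1 | h1
      · exact ⟨i, le_refl _, by omega, ihg hg _ (min_le_right _ _) i hi h1, fun n _ _ => by omega⟩
      · exact absurd h1.2 (hend _ hl d hd)
    | succ m ih =>
      rcases (h d hd i hi).1 hv with h1 | h1
      · exact ⟨i, le_refl _, by omega, ihg hg _ (min_le_right _ _) i hi h1, fun n _ _ => by omega⟩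
      · obtain ⟨j, hj, hjk, hgj, hfj⟩ := ih (i+1) (by omega) h1.2 (by omega)
        refine ⟨j, by omega, hjk, hgj, fun n hn hnj => ?_⟩
        rcases Nat.eq_or_lt_of_le hn with rfl | hn
        · exact ihf hf _ (min_le_right _ _) _ hi h1.1
        · exact hfj n hn hnj
  | rels f g ihf ihg =>
    rintro ⟨hf, hg, h, hl, -⟩ d hd i hi hv
    have key : ∀ i, i ≤ k → pV v g d i → pV v f d i → 
        PLTL.satNL L s' (k+1) (.rels f g) i := by
      intro i hi h1 h2
      refine ⟨i, le_refl _, by omega, ihf hf _ (min_le_right _ _) i hi h2, fun n _ _ => ?_⟩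
      obtain rfl : n = i := by omega
      exact ihg hg _ (min_le_right _ _) _ hi h1
    obtain ⟨m, hm⟩ : ∃ m, m = k - i := ⟨_, rfl⟩
    induction m generalizing i with
    | zero =>
      obtain rfl : i = k := by omega
      obtain ⟨h1, h2 | h2⟩ := (h d hd i hi).1 hv
      · exact key i hi h1 h2
      · exact absurd h2 (hend _ hl d hd)
    | succ m ih =>
      obtain ⟨h1, h2 | h2⟩ := (h d hd i hi).1 hv
      · exact key i hi h1 h2
      · obtain ⟨j, hj, hjk, hfj, hgj⟩ := ih (i+1) (by omega) h2 (by omega)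
        refine ⟨j, by omega, hjk, hfj, fun n hn hnj => ?_⟩
        rcases Nat.eq_or_lt_of_le hn with rfl | hn
        · exact ihg hg _ (min_le_right _ _) _ hi h1
        · exact hgj n hn hnj
  | prev f ihf =>
    rintro ⟨hf, h0, h1, h2, -⟩ d hd i hi hv
    rcases Nat.eq_zero_or_pos i with rfl | hi0
    · exact absurd hv (h0 d hd)
    refine ⟨hi0, ?_⟩
    rcases Nat.eq_zero_or_pos d with rfl | hd0
    · exact ihf hf _ (min_le_right _ _) (i-1) (by omega) ((h1 i hi0 hi).1 hv)
    · rcases (h2 d hd0 hd i hi0 hi).1 hv with h3 | h3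
      · exact absurd h3.1 (hls i hi0 hi)
      · exact ihf hf _ (min_le_right _ _) (i-1) (by omega) h3.2
  | wprev f ihf =>
    rintro ⟨hf, h0, h1, h2, -⟩ d hd i hi hv
    rcases Nat.eq_zero_or_pos i with rfl | hi0
    · exact Or.inl rfl
    refine Or.inr ?_
    rcases Nat.eq_zero_or_pos d with rfl | hd0
    · exact ihf hf _ (min_le_right _ _) (i-1) (by omega) ((h1 i hi0 hi).1 hv)
    · rcases (h2 d hd0 hd i hi0 hi).1 hv with h3 | h3
      · exact absurd h3.1 (hls i hi0 hi)
      · exact ihf hf _ (min_le_right _ _) (i-1) (by omega) h3.2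
  | since f g ihf ihg =>
    rintro ⟨hf, hg, h0, h1, h2, -⟩ d hd i hi hv
    have key : ∀ i, i ≤ k → pV v g d i → PLTL.satNL L s' (k+1) (.since f g) i := by
      intro i hi h1
      exact ⟨i, le_refl _, ihg hg _ (min_le_right _ _) i hi h1, fun n _ _ => by omega⟩
    have step : ∀ i, i + 1 ≤ k → v (.since f g) d (i+1) → (pV v g d (i+1) ∨ (pV v f d (i+1) ∧
        v (.since f g) d i)) := by
      intro i hi hv
      rcases Nat.eq_zero_or_pos d with rfl | hd0
      · exact (h1 (i+1) (by omega) hi).1 hv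
      · have := (h2 d hd0 hd (i+1) (by omega) hi).1 hv
        have h3 := hls (i+1) (by omega) hi
        simp only [Nat.add_sub_cancel] at this
        tauto
    induction i with
    | zero => exact key 0 hi ((h0 d hd).1 hv)
    | succ i ih =>
      rcases step i hi hv with h3 | ⟨h3, h4⟩
      · exact key _ hi h3
      · obtain ⟨j, hj, hgj, hfj⟩ := ih (by omega) h4
        refine ⟨j, by omega, hgj, fun n hn hnj => ?_⟩
        rcases Nat.eq_or_lt_of_le hnj with rfl | hnj
        · exact ihf hf _ (min_le_right _ _) _ hi h3
        · exact hfj n hn (by omega)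
  | trig f g ihf ihg =>
    rintro ⟨hf, hg, h0, h1, h2, -⟩ d hd i hi hv
    have step : ∀ i, i + 1 ≤ k → v (.trig f g) d (i+1) → (pV v g d (i+1) ∧ (pV v f d (i+1) ∨
        v (.trig f g) d i)) := by
      intro i hi hv
      rcases Nat.eq_zero_or_pos d with rfl | hd0
      · exact (h1 (i+1) (by omega) hi).1 hv
      · have := (h2 d hd0 hd (i+1) (by omega) hi).1 hv
        have h3 := hls (i+1) (by omega) hi
        simp only [Nat.add_sub_cancel] at this
        tauto
    induction i with
    | zero =>
      intro j hj
      obtain rfl : j = 0 := by omega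
      exact Or.inl (ihg hg _ (min_le_right _ _) _ hi ((h0 d hd).1 hv))
    | succ i ih =>
      obtain ⟨h3, h4⟩ := step i hi hv
      intro j hj
      rcases Nat.eq_or_lt_of_le hj with rfl | hj
      · exact Or.inl (ihg hg _ (min_le_right _ _) _ hi h3)
      rcases h4 with h4 | h4
      · exact Or.inr ⟨i+1, hj, le_refl _, ihf hf _ (min_le_right _ _) _ hi h4⟩
      · rcases ih (by omega) h4 j (by omega) with h5 | ⟨n, h5, h6, h7⟩
        · exact Or.inl h5
        · exact Or.inr ⟨n, h5, by omega, h7⟩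

theorem nl_last (K : ℕ) (L : S → Set AP) (s : ℕ → S) (φ : PLTL AP) :
    incLastC true K (fun _ => False) False
      (fun φ _ i => i ≤ K ∧ PLTL.satNL L s K φ i)
      (fun φ _ => K ≤ K ∧ PLTL.satNL L s K φ K) (fun _ _ => False) φ := by
  intro d hd
  refine ⟨fun _ h => h, fun _ _ _ h => h.elim, fun _ => Iff.rfl, fun _ => ?_⟩
  simp [pW]

theorem nl_complete (K : ℕ) (L : S → Set AP) (s : ℕ → S) (φ : PLTL AP) :
    pincC true K L s (fun _ => False) (fun _ => False) False
      (fun φ _ i => i ≤ K ∧ PLTL.satNL L s K φ i)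
      (fun φ _ => K ≤ K ∧ PLTL.satNL L s K φ K) (fun _ _ => False)
      auxN (fun φ => auxN φ K) φ := by
  induction φ with
  | atom p => exact ⟨fun i hi => by simp [PLTL.satNL, hi], nl_last K L s _⟩
  | natom p => exact ⟨fun i hi => by simp [PLTL.satNL, hi], nl_last K L s _⟩
  | conj f g ihf ihg =>
    exact ⟨ihf, ihg, fun d _ i hi => by simp [PLTL.satNL, hi, pV], nl_last K L s _⟩
  | disj f g ihf ihg =>
    exact ⟨ihf, ihg, fun d _ i hi => by simp [PLTL.satNL, hi, pV], nl_last K L s _⟩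
  | next f ihf =>
    refine ⟨ihf, fun d _ i hi => ?_, nl_last K L s _⟩
    simp only [PLTL.satNL, pV, hi, true_and]; rfl
  | untl f g ihf ihg =>
    refine ⟨ihf, ihg, fun d _ i hi => ?_, nl_last K L s _, fun h => h, fun i _ _ => by simp [auxN],
      fun h => h.elim, fun _ => Iff.rfl⟩
    simp only [PLTL.satNL, pV, hi, true_and]
    constructor
    · rintro ⟨j, hj, hjk, hg, hf⟩
      rcases Nat.eq_or_lt_of_le hj with rfl | hj
      · exact Or.inl hg
      · exact Or.inr ⟨hf i le_rfl hj, by omega, j, hj, hjk, hg, fun n hn hnj => hf n (by omega) hnj⟩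
    · rintro (h | ⟨h, -, j, hj, hjk, hg, hf⟩)
      · exact ⟨i, le_rfl, hi, h, fun n _ _ => by omega⟩
      · refine ⟨j, by omega, hjk, hg, fun n hn hnj => ?_⟩
        rcases Nat.eq_or_lt_of_le hn with rfl | hn
        · exact h
        · exact hf n hn hnj
  | rels f g ihf ihg =>
    refine ⟨ihf, ihg, fun d _ i hi => ?_, nl_last K L s _, trivial, fun i _ _ => by simp [auxN],
      fun h => h.elim, fun _ => Iff.rfl⟩
    simp only [PLTL.satNL, pV, hi, true_and]
    constructor
    · rintro ⟨j, hj, hjk, hf, hg⟩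
      refine ⟨hg i le_rfl hj, ?_⟩
      rcases Nat.eq_or_lt_of_le hj with rfl | hj
      · exact Or.inl hf
      · exact Or.inr ⟨by omega, j, hj, hjk, hf, fun n hn hnj => hg n (by omega) hnj⟩
    · rintro ⟨h, h1 | ⟨-, j, hj, hjk, hf, hg⟩⟩
      · refine ⟨i, le_rfl, hi, h1, fun n _ _ => ?_⟩
        obtain rfl : n = i := by omega
        exact h
      · refine ⟨j, by omega, hjk, hf, fun n hn hnj => ?_⟩
        rcases Nat.eq_or_lt_of_le hn with rfl | hn
        · exact h
        · exact hg n hn hnj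
  | prev f ihf =>
    refine ⟨ihf, fun d _ h => ?_, fun i h1 h2 => ?_, fun d _ _ i h1 h2 => ?_, nl_last K L s _⟩
    · simp [PLTL.satNL] at h
    · have : i - 1 ≤ K := by omega
      simp [PLTL.satNL, pV, h2, this]; omega
    · have : i - 1 ≤ K := by omega
      simp [PLTL.satNL, pV, h2, this]; omega
  | wprev f ihf =>
    refine ⟨ihf, fun d _ => ?_, fun i h1 h2 => ?_, fun d _ _ i h1 h2 => ?_, nl_last K L s _⟩
    · simp [PLTL.satNL]
    · have : i - 1 ≤ K := by omega
      have h3 : i ≠ 0 := by omega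
      simp [PLTL.satNL, pV, h2, this, h3]
    · have : i - 1 ≤ K := by omega
      have h3 : i ≠ 0 := by omega
      simp [PLTL.satNL, pV, h2, this, h3]
  | since f g ihf ihg =>
    have step : ∀ i, 1 ≤ i → (PLTL.satNL L s K (.since f g) i ↔ (PLTL.satNL L s K g i ∨
        (PLTL.satNL L s K f i ∧ PLTL.satNL L s K (.since f g) (i-1)))) := by
      intro i hi
      simp only [PLTL.satNL]
      constructor
      · rintro ⟨j, hj, hg, hf⟩
        rcases Nat.eq_or_lt_of_le hj with rfl | hj
        · exact Or.inl hg
        · exact Or.inr ⟨hf i hj le_rfl, j, by omega, hg, fun n h1 h2 => hf n h1 (by omega)⟩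
      · rintro (h | ⟨h, j, hj, hg, hf⟩)
        · exact ⟨i, le_rfl, h, fun n _ _ => by omega⟩
        · refine ⟨j, by omega, hg, fun n h1 h2 => ?_⟩
          rcases Nat.eq_or_lt_of_le h2 with rfl | h2
          · exact h
          · exact hf n h1 (by omega)
    refine ⟨ihf, ihg, fun d _ => ?_, fun i h1 h2 => ?_, fun d _ _ i h1 h2 => ?_, nl_last K L s _⟩
    · simp only [PLTL.satNL, pV, Nat.zero_le, true_and]
      constructor
      · rintro ⟨j, hj, hg, -⟩
        obtain rfl : j = 0 := by omega
        exact hg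
      · intro h
        exact ⟨0, le_rfl, h, fun n _ _ => by omega⟩
    · have : i - 1 ≤ K := by omega
      simp only [pV, h2, this, true_and, step i h1]
    · have : i - 1 ≤ K := by omega
      simp only [pV, h2, this, true_and, step i h1]; simp
  | trig f g ihf ihg =>
    have step : ∀ i, 1 ≤ i → (PLTL.satNL L s K (.trig f g) i ↔ (PLTL.satNL L s K g i ∧
        (PLTL.satNL L s K f i ∨ PLTL.satNL L s K (.trig f g) (i-1)))) := by
      intro i hi
      simp only [PLTL.satNL]
      constructor
      · intro h
        refine ⟨(h i le_rfl).resolve_right (by rintro ⟨n, _, _, _⟩; omega), ?_⟩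
        by_cases hf : PLTL.satNL L s K f i
        · exact Or.inl hf
        · refine Or.inr fun j hj => ?_
          rcases h j (by omega) with h1 | ⟨n, h1, h2, h3⟩
          · exact Or.inl h1
          · have : n ≠ i := by rintro rfl; exact hf h3
            exact Or.inr ⟨n, h1, by omega, h3⟩
      · rintro ⟨h, h1⟩ j hj
        rcases Nat.eq_or_lt_of_le hj with rfl | hj
        · exact Or.inl h
        · rcases h1 with h1 | h1
          · exact Or.inr ⟨i, hj, le_rfl, h1⟩
          · rcases h1 j (by omega) with h1 | ⟨n, h1, h2, h3⟩
            · exact Or.inl h1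
            · exact Or.inr ⟨n, h1, by omega, h3⟩
    refine ⟨ihf, ihg, fun d _ => ?_, fun i h1 h2 => ?_, fun d _ _ i h1 h2 => ?_, nl_last K L s _⟩
    · simp only [PLTL.satNL, pV, Nat.zero_le, true_and]
      constructor
      · intro h
        exact (h 0 le_rfl).resolve_right (by rintro ⟨n, _, _, _⟩; omega)
      · intro h j hj
        obtain rfl : j = 0 := by omega
        exact Or.inl h
    · have : i - 1 ≤ K := by omega
      simp only [pV, h2, this, true_and, step i h1]
    · have : i - 1 ≤ K := by omega
      simp only [pV, h2, this, true_and, step i h1]; simp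

theorem nl_step (M : Kripke S AP) (hTot : M.Total) (χ : PLTL AP) (k : ℕ)
    (s : ℕ → S) (sE : S) (lsel inL : ℕ → Prop) (LE : Prop)
    (v : PLTL AP → ℕ → ℕ → Prop) (vE vL : PLTL AP → ℕ → Prop)
    (aux : PLTL AP → ℕ → Prop) (auxE : PLTL AP → Prop)
    (hM : ModelC M k s) (hls : ∀ i, 1 ≤ i → i ≤ k → ¬ lsel i) (hLE : ¬ LE)
    (hp : pincC true k M.L s lsel inL LE v vE vL aux auxE χ) (h0 : v χ 0 0) :
    IncSat M χ (k+1) := by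
  obtain ⟨t, ht⟩ := hTot (s k)
  let s' : ℕ → S := fun i => if i ≤ k then s i else t
  have hs : ∀ i, i ≤ k → s' i = s i := fun i hi => if_pos hi
  have hs1 : s' (k+1) = t := if_neg (by omega)
  refine ⟨s', s' (k+1), fun _ => False, fun _ => False, False,
    fun φ _ i => i ≤ k+1 ∧ PLTL.satNL M.L s' (k+1) φ i,
    fun φ _ => k+1 ≤ k+1 ∧ PLTL.satNL M.L s' (k+1) φ (k+1), fun _ _ => False,
    auxN, fun φ => auxN φ (k+1), ?_, ?_, nl_complete _ _ _ _, by omega, ?_⟩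
  · refine ⟨by rw [hs 0 (by omega)]; exact hM.1, fun i h1 h2 => ?_⟩
    rcases Nat.eq_or_lt_of_le h2 with rfl | h2
    · rw [hs1, Nat.add_sub_cancel, hs k le_rfl]; exact ht
    · rw [hs i (by omega), hs (i-1) (by omega)]; exact hM.2 i h1 (by omega)
  · simp [incLoopC]
  · refine nl_sound k M.L s s' lsel inL LE v vE vL aux auxE hLE hls hs ?_ χ hp 0 (by omega) 0
      (by omega) h0
    intro φ hl d hd hv
    exact (hl _ (min_le_right (d+1) φ.delta)).1 hLE (((hl d hd).2.2.2 rfl).1 hv)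

/-! ### loop case -/

theorem pV_le (v : PLTL AP → ℕ → ℕ → Prop) (φ : PLTL AP) {d : ℕ} (i : ℕ) (h : d ≤ φ.delta) :
    pV v φ d i = v φ d i := by
  simp [pV, min_eq_left h]

theorem pV_clip (v : PLTL AP → ℕ → ℕ → Prop) (φ : PLTL AP) (d i : ℕ) {e : ℕ} (h : φ.delta ≤ e) :
    pV v φ (min d e) i = pV v φ d i := by
  simp only [pV, min_assoc, min_eq_right h]

theorem pV_ge (v : PLTL AP → ℕ → ℕ → Prop) (φ : PLTL AP) {d : ℕ} (i : ℕ) (h : φ.delta ≤ d) :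
    pV v φ d i = v φ φ.delta i := by
  simp only [pV, min_eq_right h]

/-- backward recursion for junk values of until. -/
def untJ (A B : ℕ → Prop) (b : Prop) (l : ℕ) : ℕ → Prop
  | 0 => b
  | m + 1 => B (l - m) ∨ (A (l - m) ∧ untJ A B b l m)

def relJ (A B : ℕ → Prop) (b : Prop) (l : ℕ) : ℕ → Prop
  | 0 => b
  | m + 1 => B (l - m) ∧ (A (l - m) ∨ relJ A B b l m)

def sinJ (A B : ℕ → Prop) : ℕ → Prop
  | 0 => B 0
  | i + 1 => B (i + 1) ∨ (A (i + 1) ∧ sinJ A B i)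

def triJ (A B : ℕ → Prop) : ℕ → Prop
  | 0 => B 0
  | i + 1 => B (i + 1) ∧ (A (i + 1) ∨ triJ A B i)

open Classical in
noncomputable def mix (v : PLTL AP → ℕ → ℕ → Prop) (l k : ℕ) (φ : PLTL AP) (d i : ℕ) (J : Prop) :
    Prop :=
  if i = k + 2 then pV v φ (d + 1) (l + 1) else if d = 0 ∨ l + 1 ≤ i then v φ d i else J

noncomputable def nv (v : PLTL AP → ℕ → ℕ → Prop) (l k : ℕ) : PLTL AP → ℕ → ℕ → Prop
  | .atom p, d, i => mix v l k (.atom p) d i False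
  | .natom p, d, i => mix v l k (.natom p) d i False
  | .conj f g, d, i => mix v l k (.conj f g) d i
      (nv v l k f (min d f.delta) i ∧ nv v l k g (min d g.delta) i)
  | .disj f g, d, i => mix v l k (.disj f g) d i
      (nv v l k f (min d f.delta) i ∨ nv v l k g (min d g.delta) i)
  | .next f, d, i => mix v l k (.next f) d i (nv v l k f (min d f.delta) (i + 1))
  | .untl f g, d, i => mix v l k (.untl f g) d i
      (untJ (fun j => nv v l k f (min d f.delta) j) (fun j => nv v l k g (min d g.delta) j)
        (v (.untl f g) d (l + 1)) l (l + 1 - i))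
  | .rels f g, d, i => mix v l k (.rels f g) d i
      (relJ (fun j => nv v l k f (min d f.delta) j) (fun j => nv v l k g (min d g.delta) j)
        (v (.rels f g) d (l + 1)) l (l + 1 - i))
  | .prev f, d, i => mix v l k (.prev f) d i (i ≠ 0 ∧ nv v l k f (min d f.delta) (i - 1))
  | .wprev f, d, i => mix v l k (.wprev f) d i (i = 0 ∨ nv v l k f (min d f.delta) (i - 1))
  | .since f g, d, i => mix v l k (.since f g) d i
      (sinJ (fun j => nv v l k f (min d f.delta) j) (fun j => nv v l k g (min d g.delta) j) i)
  | .trig f g, d, i => mix v l k (.trig f g) d i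
      (triJ (fun j => nv v l k f (min d f.delta) j) (fun j => nv v l k g (min d g.delta) j) i)

theorem mix_reg (v : PLTL AP → ℕ → ℕ → Prop) {l k : ℕ} (φ : PLTL AP) {d i : ℕ} (J : Prop)
    (h : d = 0 ∨ l + 1 ≤ i) (hi : i ≤ k + 1) : mix v l k φ d i J = v φ d i := by
  unfold mix
  rw [if_neg (by omega), if_pos h]

theorem mix_end (v : PLTL AP → ℕ → ℕ → Prop) (l k : ℕ) (φ : PLTL AP) (d : ℕ) (J : Prop) :
    mix v l k φ d (k + 2) J = pV v φ (d + 1) (l + 1) := by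
  unfold mix
  rw [if_pos rfl]

theorem mix_junk (v : PLTL AP → ℕ → ℕ → Prop) {l k : ℕ} (φ : PLTL AP) {d i : ℕ} (J : Prop)
    (h : d ≠ 0) (hi : i ≤ l) (hl : l ≤ k) : mix v l k φ d i J = J := by
  unfold mix
  rw [if_neg (by omega), if_neg (by omega)]

theorem nv_reg (v : PLTL AP → ℕ → ℕ → Prop) {l k : ℕ} (φ : PLTL AP) {d i : ℕ}
    (h : d = 0 ∨ l + 1 ≤ i) (hi : i ≤ k + 1) : nv v l k φ d i = v φ d i := by
  cases φ <;> exact mix_reg v _ _ h hi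

theorem nv_end (v : PLTL AP → ℕ → ℕ → Prop) (l k : ℕ) (φ : PLTL AP) (d : ℕ) :
    nv v l k φ d (k + 2) = pV v φ (d + 1) (l + 1) := by
  cases φ <;> exact mix_end v _ _ _ _ _

theorem pV_reg (v : PLTL AP → ℕ → ℕ → Prop) {l k : ℕ} (φ : PLTL AP) {d i : ℕ}
    (h : d = 0 ∨ l + 1 ≤ i) (hi : i ≤ k + 1) : pV (nv v l k) φ d i = pV v φ d i := by
  unfold pV
  rw [nv_reg v φ _ hi]
  rcases h with rfl | h
  · simp
  · exact Or.inr h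

theorem pV_end (v : PLTL AP → ℕ → ℕ → Prop) (l k : ℕ) (φ : PLTL AP) (d : ℕ) :
    pV (nv v l k) φ d (k + 2) = pV v φ (d + 1) (l + 1) := by
  show nv v l k φ _ _ = _
  rw [nv_end]
  unfold pV
  congr 1
  omega

/-- monotone boolean functions are idempotent on loops. -/
theorem idem (F : ℕ → Prop → Prop) (hF : ∀ i p q, (p → q) → F i p → F i q) (X Y : ℕ → Prop)
    (x0 : Prop) (l k : ℕ) (hlk : l ≤ k) (hX0 : X l ↔ F l x0) (hY0 : Y l ↔ F l (X k))
    (hX : ∀ i, l ≤ i → i + 1 ≤ k → (X (i + 1) ↔ F (i + 1) (X i)))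
    (hY : ∀ i, l ≤ i → i + 1 ≤ k → (Y (i + 1) ↔ F (i + 1) (Y i))) : Y k ↔ X k := by
  by_cases hk : X k
  · have : ∀ i, l ≤ i → i ≤ k → X i → Y i := by
      intro i hi
      induction i, hi using Nat.le_induction with
      | base => intro _ h; exact hY0.2 (hF _ _ _ (fun _ => hk) (hX0.1 h))
      | succ i hi ih =>
        intro hik h
        exact (hY i hi hik).2 (hF _ _ _ (ih (by omega)) ((hX i hi hik).1 h))
    exact ⟨fun _ => hk, this k hlk le_rfl⟩
  · have : ∀ i, l ≤ i → i ≤ k → Y i → X i := by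
      intro i hi
      induction i, hi using Nat.le_induction with
      | base => intro _ h; exact hX0.2 (hF _ _ _ (fun h => absurd h hk) (hY0.1 h))
      | succ i hi ih =>
        intro hik h
        exact (hX i hi hik).2 (hF _ _ _ (ih (by omega)) ((hY i hi hik).1 h))
    exact ⟨this k hlk le_rfl, fun h => absurd h hk⟩

/-- Normal form of a since/trigger recursion over all unrollings. -/
theorem past_norm (F : ℕ → ℕ → Prop → Prop) (hF : ∀ d i p q, (p → q) → F d i p → F d i q)
    (W : ℕ → ℕ → Prop) (m l k : ℕ) (hl1 : 1 ≤ l) (hlk : l ≤ k)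
    (hFm : ∀ d i, F (min d m) i = F d i)
    (h1 : ∀ i, 1 ≤ i → i ≤ k → (W 0 i ↔ F 0 i (W 0 (i - 1))))
    (h2 : ∀ d, 1 ≤ d → d ≤ m + 1 → ∀ i, 1 ≤ i → i ≤ k →
      (W d i ↔ F d i ((i = l ∧ W (d - 1) k) ∨ (i ≠ l ∧ W d (i - 1))))) :
    (∀ d i, 1 ≤ i → i ≤ k → (d = 0 ∨ i ≠ l) →
      (W (min d (m + 1)) i ↔ F d i (W (min d (m + 1)) (i - 1)))) ∧
    (∀ d, W (min (d + 1) (m + 1)) l ↔ F (d + 1) l (W (min d (m + 1)) k)) := by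
  have hFm1 : ∀ d i, F (min d (m + 1)) i = F d i := by
    intro d i
    rw [← hFm (min d (m + 1)), ← hFm d]; congr 1; omega
  have step : ∀ d i, 1 ≤ i → i ≤ k → (d = 0 ∨ i ≠ l) →
      (W (min d (m + 1)) i ↔ F d i (W (min d (m + 1)) (i - 1))) := by
    intro d i hi hik hd
    rcases Nat.eq_zero_or_pos d with rfl | hd0
    · simpa using h1 i hi hik
    · have hil : i ≠ l := by omega
      have := h2 (min d (m + 1)) (by omega) (by omega) i hi hik
      simpa [hil, hFm1] using this
  have loop : ∀ d, d ≤ m → (W (d + 1) l ↔ F (d + 1) l (W d k)) := by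
    intro d hd
    simpa using h2 (d + 1) (by omega) (by omega) l hl1 hlk
  refine ⟨step, fun d => ?_⟩
  rcases Nat.lt_or_ge m d with hd | hd
  · have key : W (m + 1) k ↔ W m k := by
      have hsm : ∀ i, F (m + 1) i = F m i := fun i => by rw [← hFm (m + 1) i]; congr 1; omega
      have hstep : ∀ d, (d = m ∨ d = m + 1) → ∀ i, l ≤ i → i + 1 ≤ k →
          (W d (i + 1) ↔ F (m + 1) (i + 1) (W d i)) := by
        intro d hd i hi hik
        have h3 := step d (i + 1) (by omega) hik (by omega)
        rw [min_eq_left (by omega : d ≤ m + 1)] at h3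
        rcases hd with rfl | rfl
        · rw [hsm]; simpa using h3
        · simpa using h3
      obtain ⟨x0, hx0⟩ : ∃ x0, (W m l ↔ F (m + 1) l x0) := by
        rcases Nat.eq_zero_or_pos m with rfl | hm
        · exact ⟨_, by rw [hsm]; exact h1 l hl1 hlk⟩
        · obtain ⟨n, rfl⟩ : ∃ n, m = n + 1 := ⟨m - 1, by omega⟩
          exact ⟨_, by rw [hsm]; exact loop n (by omega)⟩
      exact idem (F (m + 1)) (hF (m + 1)) (W m) (W (m + 1)) x0 l k hlk hx0 (loop m le_rfl)
        (hstep m (Or.inl rfl)) (hstep (m + 1) (Or.inr rfl))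
    have e1 : min (d + 1) (m + 1) = m + 1 := by omega
    have e2 : min d (m + 1) = m + 1 := by omega
    have e3 : F (d + 1) l = F (m + 1) l := by rw [← hFm1 (d + 1), e1]
    rw [e1, e2, e3, key]
    exact loop m le_rfl
  · have e1 : min (d + 1) (m + 1) = d + 1 := by omega
    have e2 : min d (m + 1) = d := by omega
    rw [e1, e2]
    exact loop d hd

def auxL (v : PLTL AP → ℕ → ℕ → Prop) (l : ℕ) : PLTL AP → ℕ → Prop
  | .untl _ g, i => ∃ j, l + 1 ≤ j ∧ j ≤ i ∧ v g g.delta j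
  | .rels _ g, i => ∀ j, l + 1 ≤ j → j ≤ i → v g g.delta j
  | _, _ => False

theorem l_last (v : PLTL AP → ℕ → ℕ → Prop) (l k : ℕ) (hlk : l ≤ k) (φ : PLTL AP) :
    incLastC true (k + 1) (fun i => i = l + 1) True (nv v l k)
      (fun φ d => v φ d (k + 1)) (fun φ d => v φ d (l + 1)) φ := by
  intro d hd
  refine ⟨fun h => absurd trivial h, ?_, fun _ => ?_, fun _ => ?_⟩
  · rintro i h1 h2 rfl
    rw [nv_reg v φ (Or.inr le_rfl) h2]
  · rw [nv_reg v φ (Or.inr (by omega)) le_rfl]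
  · show nv v l k φ d (k + 2) ↔ _
    rw [nv_end]; rfl

theorem l_main (k l : ℕ) (L : S → Set AP) (s s' : ℕ → S) (lsel inL : ℕ → Prop) (LE : Prop)
    (v : PLTL AP → ℕ → ℕ → Prop) (vE vL : PLTL AP → ℕ → Prop) (aux : PLTL AP → ℕ → Prop)
    (auxE : PLTL AP → Prop) (hLE : LE) (hl1 : 1 ≤ l) (hlk : l ≤ k)
    (hls : ∀ i, 1 ≤ i → i ≤ k → (lsel i ↔ i = l)) (hin : ∀ i, i ≤ k → (inL i ↔ l ≤ i))
    (hs : ∀ i, i ≤ k → s' i = s i) (hs1 : s' (k + 1) = s l) (φ : PLTL AP) :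
    pincC true k L s lsel inL LE v vE vL aux auxE φ →
    pincC true (k + 1) L s' (fun i => i = l + 1) (fun i => l + 1 ≤ i) True (nv v l k)
      (fun φ d => v φ d (k + 1)) (fun φ d => v φ d (l + 1)) (auxL v l)
      (fun φ => auxL v l φ (k + 1)) φ := by
  have shift : ∀ {φ : PLTL AP}, incLastC true k lsel LE v vE vL φ → ∀ d,
      (pV v φ d (k + 1) ↔ pV v φ (d + 1) l) := by
    intro φ h d
    have h1 := (h (min d φ.delta) (min_le_right _ _)).2.2.2 rfl
    have h2 := (h (min (min d φ.delta + 1) φ.delta) (min_le_right _ _)).2.1 l hl1 hlk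
      ((hls l hl1 hlk).2 rfl)
    have e : min (min d φ.delta + 1) φ.delta = min (d + 1) φ.delta := by omega
    unfold pV
    rw [h1]; unfold pW; rw [h2, e]
  have hE : ∀ {φ : PLTL AP}, incLastC true k lsel LE v vE vL φ → ∀ d, d ≤ φ.delta →
      (vE φ d ↔ v φ d k) := fun h d hd => (h d hd).2.2.1 rfl
  have last := fun φ => l_last v l k hlk φ
  induction φ with
  | atom p =>
    rintro ⟨h, hl⟩
    refine ⟨fun i hi => ?_, last _⟩
    rw [nv_reg v _ (Or.inl rfl) hi]
    rcases Nat.eq_or_lt_of_le hi with rfl | hi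
    · rw [hs1, ← h l hlk]; exact shift hl 0
    · rw [hs i (by omega), ← h i (by omega)]
  | natom p =>
    rintro ⟨h, hl⟩
    refine ⟨fun i hi => ?_, last _⟩
    rw [nv_reg v _ (Or.inl rfl) hi]
    rcases Nat.eq_or_lt_of_le hi with rfl | hi
    · rw [hs1, ← h l hlk]; exact shift hl 0
    · rw [hs i (by omega), ← h i (by omega)]
  | conj f g ihf ihg =>
    rintro ⟨hf, hg, h, hl⟩
    have df : f.delta ≤ (PLTL.conj f g).delta := le_max_left _ _
    have dg : g.delta ≤ (PLTL.conj f g).delta := le_max_right _ _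
    have hV : ∀ d i, i ≤ k → (pV v (.conj f g) d i ↔ (pV v f d i ∧ pV v g d i)) := by
      intro d i hi
      have := h (min d (PLTL.conj f g).delta) (min_le_right _ _) i hi
      rwa [pV_clip v f d i df, pV_clip v g d i dg] at this
    refine ⟨ihf hf, ihg hg, fun d hd i hi => ?_, last _⟩
    by_cases hr : d = 0 ∨ l + 1 ≤ i
    · rw [nv_reg v _ hr hi, pV_reg v f hr hi, pV_reg v g hr hi, ← pV_le v _ i hd]
      rcases Nat.eq_or_lt_of_le hi with rfl | hi
      · rw [shift hl, shift (pinc_last hf), shift (pinc_last hg), hV _ _ hlk]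
      · exact hV d i (by omega)
    · exact iff_of_eq (mix_junk v (.conj f g) _ (by omega) (by omega) hlk)
  | disj f g ihf ihg =>
    rintro ⟨hf, hg, h, hl⟩
    have df : f.delta ≤ (PLTL.disj f g).delta := le_max_left _ _
    have dg : g.delta ≤ (PLTL.disj f g).delta := le_max_right _ _
    have hV : ∀ d i, i ≤ k → (pV v (.disj f g) d i ↔ (pV v f d i ∨ pV v g d i)) := by
      intro d i hi
      have := h (min d (PLTL.disj f g).delta) (min_le_right _ _) i hi
      rwa [pV_clip v f d i df, pV_clip v g d i dg] at this
    refine ⟨ihf hf, ihg hg, fun d hd i hi => ?_, last _⟩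
    by_cases hr : d = 0 ∨ l + 1 ≤ i
    · rw [nv_reg v _ hr hi, pV_reg v f hr hi, pV_reg v g hr hi, ← pV_le v _ i hd]
      rcases Nat.eq_or_lt_of_le hi with rfl | hi
      · rw [shift hl, shift (pinc_last hf), shift (pinc_last hg), hV _ _ hlk]
      · exact hV d i (by omega)
    · exact iff_of_eq (mix_junk v (.disj f g) _ (by omega) (by omega) hlk)
  | next f ihf =>
    rintro ⟨hf, h, hl⟩
    have hV : ∀ d i, i ≤ k → (pV v (.next f) d i ↔ pV v f d (i + 1)) := by
      intro d i hi
      have := h (min d (PLTL.next f).delta) (min_le_right _ _) i hi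
      have df : f.delta ≤ (PLTL.next f).delta := le_refl f.delta
      rwa [pV_clip v f d _ df] at this
    refine ⟨ihf hf, fun d hd i hi => ?_, last _⟩
    by_cases hr : d = 0 ∨ l + 1 ≤ i
    · rw [nv_reg v _ hr hi, ← pV_le v _ i hd]
      rcases Nat.eq_or_lt_of_le hi with rfl | hi
      · rw [shift hl, pV_end, hV _ _ hlk]
      · rw [pV_reg v f (by omega) (by omega)]
        exact hV d i (by omega)
    · exact iff_of_eq (mix_junk v (.next f) _ (by omega) (by omega) hlk)
  | untl f g ihf ihg =>
    rintro ⟨hf, hg, h, hl, ha0, ha, haE, haK⟩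
    have df : f.delta ≤ (PLTL.untl f g).delta := le_max_left _ _
    have dg : g.delta ≤ (PLTL.untl f g).delta := le_max_right _ _
    have hV : ∀ d i, i ≤ k → (pV v (.untl f g) d i ↔ (pV v g d i ∨ (pV v f d i ∧
        pV v (.untl f g) d (i + 1)))) := by
      intro d i hi
      have := h (min d (PLTL.untl f g).delta) (min_le_right _ _) i hi
      rwa [pV_clip v f d i df, pV_clip v g d i dg] at this
    refine ⟨ihf hf, ihg hg, fun d hd i hi => ?_, last _, ?_, fun i h1 h2 => ?_, fun _ hv => ?_,
      fun _ => Iff.rfl⟩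
    · by_cases hr : d = 0 ∨ l + 1 ≤ i
      · rw [nv_reg v _ hr hi, pV_reg v f hr hi, pV_reg v g hr hi, ← pV_le v _ i hd,
          ← pV_le (nv v l k) _ _ hd]
        rcases Nat.eq_or_lt_of_le hi with rfl | hi
        · rw [shift hl, shift (pinc_last hf), shift (pinc_last hg), pV_end, hV _ _ hlk]
        · rw [pV_reg v (.untl f g) (by omega) (by omega)]
          exact hV d i (by omega)
      · have e1 : nv v l k (.untl f g) d i = untJ (fun j => nv v l k f (min d f.delta) j)
          (fun j => nv v l k g (min d g.delta) j) (v (.untl f g) d (l + 1)) l (l + 1 - i) :=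
          mix_junk v (.untl f g) _ (by omega) (by omega) hlk
        have e2 : nv v l k (.untl f g) d (i + 1) = untJ (fun j => nv v l k f (min d f.delta) j)
          (fun j => nv v l k g (min d g.delta) j) (v (.untl f g) d (l + 1)) l (l - i) := by
          rcases Nat.eq_or_lt_of_le (by omega : i ≤ l) with rfl | hil
          · rw [nv_reg v _ (Or.inr le_rfl) (by omega)]; simp [untJ]
          · have := mix_junk v (.untl f g) (untJ (fun j => nv v l k f (min d f.delta) j)
              (fun j => nv v l k g (min d g.delta) j) (v (.untl f g) d (l + 1)) l
              (l + 1 - (i + 1))) (by omega : d ≠ 0) (by omega : i + 1 ≤ l) hlk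
            rw [Nat.add_sub_add_right] at this
            rw [← this]; simp only [nv, Nat.add_sub_add_right]
        rw [e1, e2, (by omega : l + 1 - i = (l - i) + 1), untJ, (by omega : l - (l - i) = i)]
        rfl
    · rintro ⟨j, h1, h2, -⟩; omega
    · constructor
      · rintro ⟨j, h3, h4, h5⟩
        rcases Nat.eq_or_lt_of_le h4 with rfl | h4
        · exact Or.inr ⟨h3, by rwa [nv_reg v _ (Or.inr h3) h2]⟩
        · exact Or.inl ⟨j, h3, by omega, h5⟩
      · rintro (⟨j, h3, h4, h5⟩ | ⟨h3, h4⟩)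
        · exact ⟨j, h3, by omega, h5⟩
        · rw [nv_reg v _ (Or.inr h3) h2] at h4
          exact ⟨i, h3, le_rfl, h4⟩
    · by_contra hno
      have hno' : ∀ j, l + 1 ≤ j → j ≤ k + 1 → ¬ v g g.delta j :=
        fun j h1 h2 h3 => hno ⟨j, h1, h2, h3⟩
      have hgl : ¬ v g g.delta l := by
        have h3 := shift (pinc_last hg) g.delta
        rw [pV_ge v g _ le_rfl, pV_ge v g _ (by omega)] at h3
        rw [← h3]; exact hno' _ (by omega) le_rfl
      have hng : ∀ j, l ≤ j → j ≤ k → ¬ v g g.delta j := by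
        intro j h1 h2
        rcases Nat.eq_or_lt_of_le h1 with rfl | h1
        · exact hgl
        · exact hno' j h1 (by omega)
      have hul : pV v (.untl f g) (PLTL.untl f g).delta l := by
        have h3 := shift hl (PLTL.untl f g).delta
        rw [pV_ge v _ _ le_rfl, pV_ge v _ _ (by omega)] at h3
        rw [pV_ge v _ _ le_rfl]; exact h3.1 hv
      have hu : ∀ j, l ≤ j → j ≤ k → pV v (.untl f g) (PLTL.untl f g).delta j := by
        intro j h1
        induction j, h1 using Nat.le_induction with
        | base => intro _; exact hul
        | succ j h1 ih =>
          intro h2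
          have h3 := (hV _ j (by omega)).1 (ih (by omega))
          rw [pV_ge v g _ dg] at h3
          exact (h3.resolve_left (hng j h1 (by omega))).2
      have huk := hu k hlk le_rfl
      rw [pV_ge v _ _ le_rfl, ← hE hl _ le_rfl] at huk
      have hak := (haK rfl).1 (haE hLE huk)
      have : ∀ j, j ≤ k → ¬ aux (.untl f g) j := by
        intro j
        induction j with
        | zero => intro _; exact ha0
        | succ j ih =>
          intro h2 h3
          rcases (ha (j + 1) (by omega) h2).1 h3 with h4 | ⟨h4, h5⟩
          · exact ih (by omega) h4
          · exact hng _ ((hin _ h2).1 h4) h2 h5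
      exact this k le_rfl hak
  | rels f g ihf ihg =>
    rintro ⟨hf, hg, h, hl, ha0, ha, haE, haK⟩
    have df : f.delta ≤ (PLTL.rels f g).delta := le_max_left _ _
    have dg : g.delta ≤ (PLTL.rels f g).delta := le_max_right _ _
    have hV : ∀ d i, i ≤ k → (pV v (.rels f g) d i ↔ (pV v g d i ∧ (pV v f d i ∨
        pV v (.rels f g) d (i + 1)))) := by
      intro d i hi
      have := h (min d (PLTL.rels f g).delta) (min_le_right _ _) i hi
      rwa [pV_clip v f d i df, pV_clip v g d i dg] at this
    refine ⟨ihf hf, ihg hg, fun d hd i hi => ?_, last _, ?_, fun i h1 h2 => ?_, fun _ hv => ?_,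
      fun _ => Iff.rfl⟩
    · by_cases hr : d = 0 ∨ l + 1 ≤ i
      · rw [nv_reg v _ hr hi, pV_reg v f hr hi, pV_reg v g hr hi, ← pV_le v _ i hd,
          ← pV_le (nv v l k) _ _ hd]
        rcases Nat.eq_or_lt_of_le hi with rfl | hi
        · rw [shift hl, shift (pinc_last hf), shift (pinc_last hg), pV_end, hV _ _ hlk]
        · rw [pV_reg v (.rels f g) (by omega) (by omega)]
          exact hV d i (by omega)
      · have e1 : nv v l k (.rels f g) d i = relJ (fun j => nv v l k f (min d f.delta) j)
          (fun j => nv v l k g (min d g.delta) j) (v (.rels f g) d (l + 1)) l (l + 1 - i) :=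
          mix_junk v (.rels f g) _ (by omega) (by omega) hlk
        have e2 : nv v l k (.rels f g) d (i + 1) = relJ (fun j => nv v l k f (min d f.delta) j)
          (fun j => nv v l k g (min d g.delta) j) (v (.rels f g) d (l + 1)) l (l - i) := by
          rcases Nat.eq_or_lt_of_le (by omega : i ≤ l) with rfl | hil
          · rw [nv_reg v _ (Or.inr le_rfl) (by omega)]; simp [relJ]
          · have := mix_junk v (.rels f g) (relJ (fun j => nv v l k f (min d f.delta) j)
              (fun j => nv v l k g (min d g.delta) j) (v (.rels f g) d (l + 1)) l
              (l + 1 - (i + 1))) (by omega : d ≠ 0) (by omega : i + 1 ≤ l) hlk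
            rw [Nat.add_sub_add_right] at this
            rw [← this]; simp only [nv, Nat.add_sub_add_right]
        rw [e1, e2, (by omega : l + 1 - i = (l - i) + 1), relJ, (by omega : l - (l - i) = i)]
        rfl
    · intro j h1 h2; omega
    · constructor
      · intro h3
        refine ⟨fun j h4 h5 => h3 j h4 (by omega), ?_⟩
        by_cases h4 : l + 1 ≤ i
        · rw [nv_reg v _ (Or.inr h4) h2]; exact Or.inr (h3 i h4 le_rfl)
        · exact Or.inl h4
      · rintro ⟨h3, h4⟩ j h5 h6
        rcases Nat.eq_or_lt_of_le h6 with rfl | h6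
        · rw [nv_reg v _ (Or.inr h5) h2] at h4
          exact h4.resolve_left (fun h => h h5)
        · exact h3 j h5 (by omega)
    · have hv' : ∀ j, l + 1 ≤ j → j ≤ k + 1 → v g g.delta j := hv
      have hgl : v g g.delta l := by
        have h3 := shift (pinc_last hg) g.delta
        rw [pV_ge v g _ le_rfl, pV_ge v g _ (by omega)] at h3
        rw [← h3]; exact hv' _ (by omega) le_rfl
      have hng : ∀ j, l ≤ j → j ≤ k → v g g.delta j := by
        intro j h1 h2
        rcases Nat.eq_or_lt_of_le h1 with rfl | h1
        · exact hgl
        · exact hv' j h1 (by omega)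
      have hak : ∀ j, j ≤ k → aux (.rels f g) j := by
        intro j
        induction j with
        | zero => intro _; exact ha0
        | succ j ih =>
          intro h2
          refine (ha (j + 1) (by omega) h2).2 ⟨ih (by omega), ?_⟩
          by_cases h4 : inL (j + 1)
          · exact Or.inr (hng _ ((hin _ h2).1 h4) h2)
          · exact Or.inl h4
      have huk : pV v (.rels f g) (PLTL.rels f g).delta k := by
        rw [pV_ge v _ _ le_rfl, ← hE hl _ le_rfl]
        exact haE hLE ((haK rfl).2 (hak k le_rfl))
      have hu : ∀ m j, l ≤ j → j ≤ k → k - j = m →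
          pV v (.rels f g) (PLTL.rels f g).delta j := by
        intro m
        induction m with
        | zero =>
          intro j h1 h2 h3
          obtain rfl : j = k := by omega
          exact huk
        | succ m ih =>
          intro j h1 h2 h3
          refine (hV _ j h2).2 ⟨?_, Or.inr (ih (j + 1) (by omega) (by omega) (by omega))⟩
          rw [pV_ge v g _ dg]; exact hng j h1 h2
      have h3 := shift hl (PLTL.rels f g).delta
      rw [pV_ge v _ _ le_rfl, pV_ge v _ _ (by omega)] at h3
      have h4 := hu _ l le_rfl hlk rfl
      rw [pV_ge v _ _ le_rfl] at h4
      exact h3.2 h4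
  | prev f ihf =>
    rintro ⟨hf, h0, h1, h2, hl⟩
    have df : f.delta ≤ (PLTL.prev f).delta := Nat.le_succ _
    have step : ∀ d i, 1 ≤ i → i ≤ k + 1 → (d = 0 ∨ i ≠ l) →
        (pV v (.prev f) d i ↔ pV v f d (i - 1)) := by
      intro d i hi hik hd
      rcases Nat.eq_or_lt_of_le hik with rfl | hik
      · rw [shift hl]
        have h3 := h2 (min (d + 1) (PLTL.prev f).delta) (by simp [PLTL.delta]) (min_le_right _ _)
          l hl1 hlk
        have e : min (d + 1) (PLTL.prev f).delta - 1 = min d f.delta := by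
          simp only [PLTL.delta]; omega
        have e2 : min (min d f.delta) f.delta = min d f.delta := by omega
        rw [e] at h3
        simp only [pW, e2, hls l hl1 hlk, true_and, not_true, false_and, or_false] at h3
        rw [hE (pinc_last hf) _ (min_le_right _ _)] at h3
        exact h3
      · rcases Nat.eq_zero_or_pos d with rfl | hd0
        · simpa [pV] using h1 i hi (by omega)
        · have hil : i ≠ l := by omega
          have h3 := h2 (min d (PLTL.prev f).delta) (by simp [PLTL.delta]; omega)
            (min_le_right _ _) i hi (by omega)
          simp only [hls i hi (by omega : i ≤ k), hil, not_false_iff, true_and, false_and,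
            false_or] at h3
          rwa [pV_clip v f d _ df] at h3
    refine ⟨ihf hf, fun d hd hv => ?_, fun i hi hik => ?_, fun d hd0 hd i hi hik => ?_, last _⟩
    · rcases Nat.eq_zero_or_pos d with rfl | hd0
      · rw [nv_reg v _ (Or.inl rfl) (by omega)] at hv
        exact h0 0 hd hv
      · have := mix_junk v (.prev f) ((0:ℕ) ≠ 0 ∧ nv v l k f (min d f.delta) (0 - 1))
          (by omega : d ≠ 0) (by omega : 0 ≤ l) hlk
        simp only [nv] at hv
        rw [this] at hv
        exact hv.1 rfl
    · rw [nv_reg v _ (Or.inl rfl) hik, pV_reg v f (Or.inl rfl) (by omega),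
        ← pV_le v _ i (Nat.zero_le _)]
      exact step 0 i hi hik (Or.inl rfl)
    · by_cases hr : l + 1 ≤ i
      · rw [nv_reg v _ (Or.inr hr) hik, ← pV_le v _ i hd, step d i hi hik (by omega)]
        by_cases hil : i = l + 1
        · subst hil
          have h3 := shift (pinc_last hf) (d - 1)
          rw [Nat.sub_add_cancel hd0] at h3
          simp only [true_and, not_true, false_and, or_false, Nat.add_sub_cancel]
          exact h3.symm
        · rw [pV_reg v f (by omega) (by omega)]
          simp [hil]
      · have e1 : nv v l k (.prev f) d i = (i ≠ 0 ∧ nv v l k f (min d f.delta) (i - 1)) :=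
          mix_junk v (.prev f) _ (by omega) (by omega) hlk
        have h3 : i ≠ l + 1 := by omega
        have h4 : i ≠ 0 := by omega
        rw [e1]; simp [h3, h4, pV]
  | wprev f ihf =>
    rintro ⟨hf, h0, h1, h2, hl⟩
    have df : f.delta ≤ (PLTL.wprev f).delta := Nat.le_succ _
    have step : ∀ d i, 1 ≤ i → i ≤ k + 1 → (d = 0 ∨ i ≠ l) →
        (pV v (.wprev f) d i ↔ pV v f d (i - 1)) := by
      intro d i hi hik hd
      rcases Nat.eq_or_lt_of_le hik with rfl | hik
      · rw [shift hl]
        have h3 := h2 (min (d + 1) (PLTL.wprev f).delta) (by simp [PLTL.delta]) (min_le_right _ _)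
          l hl1 hlk
        have e : min (d + 1) (PLTL.wprev f).delta - 1 = min d f.delta := by
          simp only [PLTL.delta]; omega
        have e2 : min (min d f.delta) f.delta = min d f.delta := by omega
        rw [e] at h3
        simp only [pW, e2, hls l hl1 hlk, true_and, not_true, false_and, or_false] at h3
        rw [hE (pinc_last hf) _ (min_le_right _ _)] at h3
        exact h3
      · rcases Nat.eq_zero_or_pos d with rfl | hd0
        · simpa [pV] using h1 i hi (by omega)
        · have hil : i ≠ l := by omega
          have h3 := h2 (min d (PLTL.wprev f).delta) (by simp [PLTL.delta]; omega)
            (min_le_right _ _) i hi (by omega)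
          simp only [hls i hi (by omega : i ≤ k), hil, not_false_iff, true_and, false_and,
            false_or] at h3
          rwa [pV_clip v f d _ df] at h3
    refine ⟨ihf hf, fun d hd => ?_, fun i hi hik => ?_, fun d hd0 hd i hi hik => ?_, last _⟩
    · rcases Nat.eq_zero_or_pos d with rfl | hd0
      · rw [nv_reg v _ (Or.inl rfl) (by omega)]
        exact h0 0 hd
      · have := mix_junk v (.wprev f) ((0:ℕ) = 0 ∨ nv v l k f (min d f.delta) (0 - 1))
          (by omega : d ≠ 0) (by omega : 0 ≤ l) hlk
        exact this.mpr (Or.inl rfl)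
    · rw [nv_reg v _ (Or.inl rfl) hik, pV_reg v f (Or.inl rfl) (by omega),
        ← pV_le v _ i (Nat.zero_le _)]
      exact step 0 i hi hik (Or.inl rfl)
    · by_cases hr : l + 1 ≤ i
      · rw [nv_reg v _ (Or.inr hr) hik, ← pV_le v _ i hd, step d i hi hik (by omega)]
        by_cases hil : i = l + 1
        · subst hil
          have h3 := shift (pinc_last hf) (d - 1)
          rw [Nat.sub_add_cancel hd0] at h3
          simp only [true_and, not_true, false_and, or_false, Nat.add_sub_cancel]
          exact h3.symm
        · rw [pV_reg v f (by omega) (by omega)]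
          simp [hil]
      · have e1 : nv v l k (.wprev f) d i = (i = 0 ∨ nv v l k f (min d f.delta) (i - 1)) :=
          mix_junk v (.wprev f) _ (by omega) (by omega) hlk
        have h3 : i ≠ l + 1 := by omega
        have h4 : i ≠ 0 := by omega
        rw [e1]; simp [h3, h4, pV]
  | since f g ihf ihg =>
    rintro ⟨hf, hg, h0, h1, h2, hl⟩
    obtain ⟨step, loop⟩ := past_norm (fun d i p => pV v g d i ∨ (pV v f d i ∧ p))
      (fun d i p q hpq => Or.imp_right (And.imp_right hpq)) (v (.since f g))
      (max f.delta g.delta) l k hl1 hlk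
      (fun d i => by rw [pV_clip v f d i (le_max_left _ _), pV_clip v g d i (le_max_right _ _)])
      h1 (fun d hd0 hd i hi hik => by
        have h3 := h2 d hd0 hd i hi hik
        rwa [hE hl (d - 1) (le_trans (Nat.sub_le _ _) hd), hls i hi hik] at h3)
    have step' : ∀ d i, 1 ≤ i → i ≤ k + 1 → (d = 0 ∨ i ≠ l) → (pV v (.since f g) d i ↔
        (pV v g d i ∨ (pV v f d i ∧ pV v (.since f g) d (i - 1)))) := by
      intro d i hi hik hd
      rcases Nat.eq_or_lt_of_le hik with rfl | hik
      · rw [shift hl, shift (pinc_last hf), shift (pinc_last hg)]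
        exact loop d
      · exact step d i hi (by omega) hd
    refine ⟨ihf hf, ihg hg, fun d hd => ?_, fun i hi hik => ?_, fun d hd0 hd i hi hik => ?_, last _⟩
    · rcases Nat.eq_zero_or_pos d with rfl | hd0
      · rw [nv_reg v _ (Or.inl rfl) (by omega), pV_reg v g (Or.inl rfl) (by omega)]
        exact h0 0 hd
      · exact iff_of_eq (mix_junk v (.since f g) (sinJ (fun j => nv v l k f (min d f.delta) j)
          (fun j => nv v l k g (min d g.delta) j) 0) (by omega : d ≠ 0) (by omega : 0 ≤ l) hlk)
    · rw [nv_reg v _ (Or.inl rfl) hik, pV_reg v f (Or.inl rfl) (by omega),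
        pV_reg v g (Or.inl rfl) (by omega), nv_reg v _ (Or.inl rfl) (by omega : i - 1 ≤ k + 1),
        ← pV_le v _ i (Nat.zero_le _), ← pV_le v _ (i - 1) (Nat.zero_le _)]
      exact step' 0 i hi hik (Or.inl rfl)
    · by_cases hr : l + 1 ≤ i
      · rw [nv_reg v _ (Or.inr hr) hik, pV_reg v f (Or.inr hr) hik, pV_reg v g (Or.inr hr) hik,
          ← pV_le v _ i hd, step' d i hi hik (by omega)]
        by_cases hil : i = l + 1
        · subst hil
          have h3 := shift hl (d - 1)
          rw [Nat.sub_add_cancel hd0, pV_le v _ _ (le_trans (Nat.sub_le _ _) hd)] at h3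
          simp only [true_and, not_true, false_and, or_false, Nat.add_sub_cancel]
          rw [h3]
        · rw [nv_reg v _ (by omega) (by omega : i - 1 ≤ k + 1), pV_le v _ (i - 1) hd]
          simp [hil]
      · have e1 : ∀ i, i ≤ l → nv v l k (.since f g) d i =
            sinJ (fun j => nv v l k f (min d f.delta) j)
              (fun j => nv v l k g (min d g.delta) j) i := fun i hi =>
          mix_junk v (.since f g) _ (by omega) (by omega) hlk
        have h3 : i ≠ l + 1 := by omega
        rw [e1 i (by omega), e1 (i - 1) (by omega)]
        obtain ⟨j, rfl⟩ : ∃ j, i = j + 1 := ⟨i - 1, by omega⟩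
        simp only [h3, false_and, false_or, not_false_iff, true_and, sinJ, Nat.add_sub_cancel]
        rfl
  | trig f g ihf ihg =>
    rintro ⟨hf, hg, h0, h1, h2, hl⟩
    obtain ⟨step, loop⟩ := past_norm (fun d i p => pV v g d i ∧ (pV v f d i ∨ p))
      (fun d i p q hpq => And.imp_right (Or.imp_right hpq)) (v (.trig f g))
      (max f.delta g.delta) l k hl1 hlk
      (fun d i => by rw [pV_clip v f d i (le_max_left _ _), pV_clip v g d i (le_max_right _ _)])
      h1 (fun d hd0 hd i hi hik => by
        have h3 := h2 d hd0 hd i hi hik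
        rwa [hE hl (d - 1) (le_trans (Nat.sub_le _ _) hd), hls i hi hik] at h3)
    have step' : ∀ d i, 1 ≤ i → i ≤ k + 1 → (d = 0 ∨ i ≠ l) → (pV v (.trig f g) d i ↔
        (pV v g d i ∧ (pV v f d i ∨ pV v (.trig f g) d (i - 1)))) := by
      intro d i hi hik hd
      rcases Nat.eq_or_lt_of_le hik with rfl | hik
      · rw [shift hl, shift (pinc_last hf), shift (pinc_last hg)]
        exact loop d
      · exact step d i hi (by omega) hd
    refine ⟨ihf hf, ihg hg, fun d hd => ?_, fun i hi hik => ?_, fun d hd0 hd i hi hik => ?_, last _⟩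
    · rcases Nat.eq_zero_or_pos d with rfl | hd0
      · rw [nv_reg v _ (Or.inl rfl) (by omega), pV_reg v g (Or.inl rfl) (by omega)]
        exact h0 0 hd
      · exact iff_of_eq (mix_junk v (.trig f g) (triJ (fun j => nv v l k f (min d f.delta) j)
          (fun j => nv v l k g (min d g.delta) j) 0) (by omega : d ≠ 0) (by omega : 0 ≤ l) hlk)
    · rw [nv_reg v _ (Or.inl rfl) hik, pV_reg v f (Or.inl rfl) (by omega),
        pV_reg v g (Or.inl rfl) (by omega), nv_reg v _ (Or.inl rfl) (by omega : i - 1 ≤ k + 1),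
        ← pV_le v _ i (Nat.zero_le _), ← pV_le v _ (i - 1) (Nat.zero_le _)]
      exact step' 0 i hi hik (Or.inl rfl)
    · by_cases hr : l + 1 ≤ i
      · rw [nv_reg v _ (Or.inr hr) hik, pV_reg v f (Or.inr hr) hik, pV_reg v g (Or.inr hr) hik,
          ← pV_le v _ i hd, step' d i hi hik (by omega)]
        by_cases hil : i = l + 1
        · subst hil
          have h3 := shift hl (d - 1)
          rw [Nat.sub_add_cancel hd0, pV_le v _ _ (le_trans (Nat.sub_le _ _) hd)] at h3
          simp only [true_and, not_true, false_and, or_false, Nat.add_sub_cancel]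
          rw [h3]
        · rw [nv_reg v _ (by omega) (by omega : i - 1 ≤ k + 1), pV_le v _ (i - 1) hd]
          simp [hil]
      · have e1 : ∀ i, i ≤ l → nv v l k (.trig f g) d i =
            triJ (fun j => nv v l k f (min d f.delta) j)
              (fun j => nv v l k g (min d g.delta) j) i := fun i hi =>
          mix_junk v (.trig f g) _ (by omega) (by omega) hlk
        have h3 : i ≠ l + 1 := by omega
        rw [e1 i (by omega), e1 (i - 1) (by omega)]
        obtain ⟨j, rfl⟩ : ∃ j, i = j + 1 := ⟨i - 1, by omega⟩
        simp only [h3, false_and, false_or, not_false_iff, true_and, triJ, Nat.add_sub_cancel]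
        rfl

theorem inc_step (M : Kripke S AP) (hTot : M.Total) (χ : PLTL AP) (k : ℕ)
    (h : IncSat M χ k) : IncSat M χ (k + 1) := by
  obtain ⟨s, sE, lsel, inL, LE, v, vE, vL, aux, auxE, hM, hL, hp, h0⟩ := h
  obtain ⟨hl0, hi0, hsel, hin, hex, hLE, hsE⟩ := hL
  have hLE := hLE rfl
  have hsE := hsE rfl
  have hmono : ∀ i j, i ≤ j → j ≤ k → inL i → inL j := by
    intro i j hij
    induction j, hij using Nat.le_induction with
    | base => exact fun _ h => h
    | succ j hj ih =>
      intro hjk h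
      exact (hin (j + 1) (by omega) hjk).2 (Or.inl (ih (by omega) h))
  by_cases hle : LE
  · have hk := hLE.1 hle
    have : ∀ i, i ≤ k → inL i → ∃ l, 1 ≤ l ∧ l ≤ i ∧ lsel l := by
      intro i
      induction i with
      | zero => intro _ h; exact absurd h hi0
      | succ i ih =>
        intro hik h
        rcases (hin (i + 1) (by omega) hik).1 h with h | h
        · obtain ⟨l, h1, h2, h3⟩ := ih (by omega) h
          exact ⟨l, h1, by omega, h3⟩
        · exact ⟨i + 1, by omega, le_rfl, h⟩
    obtain ⟨l, hl1, hlk, hl⟩ := this k le_rfl hk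
    have hlin : inL l := (hin l hl1 hlk).2 (Or.inr hl)
    have huniq : ∀ i j, 1 ≤ i → i < j → j ≤ k → lsel i → ¬ lsel j := by
      intro i j h1 h2 h3 h4
      exact hex j (by omega) h3 (hmono i (j - 1) (by omega) (by omega)
        ((hin i h1 (by omega)).2 (Or.inr h4)))
    have hls : ∀ i, 1 ≤ i → i ≤ k → (lsel i ↔ i = l) := by
      intro i h1 h2
      constructor
      · intro h3
        rcases lt_trichotomy i l with h4 | h4 | h4
        · exact absurd hl (huniq i l h1 h4 hlk h3)
        · exact h4
        · exact absurd h3 (huniq l i hl1 h4 h2 hl)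
      · rintro rfl; exact hl
    have hinl : ∀ i, i ≤ k → (inL i ↔ l ≤ i) := by
      intro i hi
      constructor
      · intro h3
        obtain ⟨l', h4, h5, h6⟩ := this i hi h3
        rw [hls l' h4 (by omega)] at h6
        omega
      · intro h3; exact hmono l i h3 hi hlin
    let s' : ℕ → S := fun i => if i ≤ k then s i else s l
    have hs : ∀ i, i ≤ k → s' i = s i := fun i hi => if_pos hi
    have hs1 : s' (k+1) = s l := if_neg (by omega)
    refine ⟨s', s' (k + 1), _, _, _, _, _, _, _, _, ?_, ?_,
      l_main k l M.L s s' lsel inL LE v vE vL aux auxE hle hl1 hlk hls hinl hs hs1 χ hp, ?_⟩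
    · refine ⟨by rw [hs 0 (by omega)]; exact hM.1, fun i h1 h2 => ?_⟩
      rcases Nat.eq_or_lt_of_le h2 with rfl | h2
      · rw [hs1, Nat.add_sub_cancel, hs k le_rfl, ← hsE, ← hsel l hl1 hlk hl]
        exact hM.2 l hl1 hlk
      · rw [hs i (by omega), hs (i-1) (by omega)]; exact hM.2 i h1 (by omega)
    · refine ⟨by omega, by omega, ?_, fun i _ _ => by omega, fun i _ _ => by omega,
        fun _ => iff_of_true trivial (by omega), fun _ => rfl⟩
      rintro i h1 h2 rfl
      rw [hs1, Nat.add_sub_cancel, hs l hlk]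
    · rw [nv_reg v χ (Or.inl rfl) (by omega)]; exact h0
  · refine nl_step M hTot χ k s sE lsel inL LE v vE vL aux auxE hM (fun i h1 h2 h3 => ?_) hle hp h0
    exact hle (hLE.2 (hmono i k h2 le_rfl ((hin i h1 h2).2 (Or.inr h3))))

end BMC

open BMC in
/-- Lemma: if the incremental PLTL eventuality encoding `⟦M,¬ψ,k⟧` is
satisfiable for some `k`, then it is satisfiable for all `k' ≥ k`. -/
theorem witness_sat_monotone {S AP : Type} [Finite S]
    (M : Kripke S AP) (hTot : M.Total) (ψ : PLTL AP) (k : ℕ)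
    (h : IncSat M ψ.neg k) :
    ∀ k', k ≤ k' → IncSat M ψ.neg k' := by
  intro k' hk
  induction k', hk using Nat.le_induction with
  | base => exact h
  | succ n hn ih => exact inc_step M hTot _ n ih
end

section
/- The bounded PLTL semantics safely under-approximates the standard semantics: for every PLTL formula ψ in positive normal form, every infinite path π, and every bound k ∈ ℕ, if π ⊨_k ψ then π ⊨ ψ. Moreover, the no-loop part is monotonically sound position-wise: for every subformula position, π^i ⊨_nl ψ implies π^i ⊨ ψ for all 0 ≤ i ≤ k. -/
theorem BMC.satNL_sound {S AP : Type} (L : S → Set AP) (π : ℕ → S)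
    (k : ℕ) (ψ : BMC.PLTL AP) :
    ∀ i, BMC.PLTL.satNL L π k ψ i → BMC.PLTL.sat L π ψ i := by
  induction ψ with
  | atom p => exact fun i h => h
  | natom p => exact fun i h => h
  | conj f g hf hg => exact fun i h => ⟨hf i h.1, hg i h.2⟩
  | disj f g hf hg => exact fun i h => h.imp (hf i) (hg i)
  | next f hf => exact fun i h => hf _ h.2
  | untl f g hf hg =>
    rintro i ⟨j, hij, _, h1, h2⟩
    exact ⟨j, hij, hg _ h1, fun n a b => hf _ (h2 n a b)⟩
  | rels f g hf hg =>
    rintro i ⟨j, hij, _, h1, h2⟩ m hm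
    rcases Nat.lt_or_ge j m with h | h
    · exact Or.inr ⟨j, hij, h, hf _ h1⟩
    · exact Or.inl (hg _ (h2 m hm h))
  | prev f hf => exact fun i h => ⟨h.1, hf _ h.2⟩
  | wprev f hf => exact fun i h => h.imp id (hf _)
  | since f g hf hg =>
    rintro i ⟨j, hij, h1, h2⟩
    exact ⟨j, hij, hg _ h1, fun n a b => hf _ (h2 n a b)⟩
  | trig f g hf hg =>
    intro i h j hj
    rcases h j hj with h | ⟨n, a, b, c⟩
    · exact Or.inl (hg _ h)
    · exact Or.inr ⟨n, a, b, hf _ c⟩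

open BMC in
/-- The bounded PLTL semantics safely under-approximates the standard
semantics: `π ⊨_k ψ` implies `π ⊨ ψ`, and position-wise the no-loop
semantics is sound: `π^i ⊨_nl ψ` implies `π^i ⊨ ψ` for all `0 ≤ i ≤ k`. -/
theorem bounded_semantics_sound {S AP : Type} (L : S → Set AP) (π : ℕ → S)
    (k : ℕ) (ψ : PLTL AP) :
    (PLTL.bsat L π k ψ → PLTL.sat L π ψ 0) ∧
    (∀ i, i ≤ k → PLTL.satNL L π k ψ i → PLTL.sat L π ψ i) := by
  refine ⟨?_, fun i _ h => BMC.satNL_sound L π k ψ i h⟩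
  rintro (⟨_, _, h⟩ | h)
  · exact h
  · exact BMC.satNL_sound L π k ψ 0 h
end

section
/- The bounded PLTL semantics is eventually complete on finite models: for every finite Kripke structure M and PLTL formula ψ, there exists k ∈ ℕ such that M has an initialised infinite path π with π ⊨ ψ if and only if M has an initialised infinite path π' with π' ⊨_k ψ. In particular, for every ultimately periodic infinite path π represented as a (k,l)-loop, the bounded semantics coincides with the standard semantics: π ⊨_k ψ iff π ⊨ ψ. -/
namespace BMC

theorem satNL_sat {AP S : Type} (L : S → Set AP) (π : ℕ → S) (k : ℕ) (f : PLTL AP) :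
    ∀ i, PLTL.satNL L π k f i → PLTL.sat L π f i := by
  induction f with
  | atom p => intro i h; exact h
  | natom p => intro i h; exact h
  | conj f g hf hg => intro i h; exact ⟨hf _ h.1, hg _ h.2⟩
  | disj f g hf hg => intro i h; exact h.imp (hf _) (hg _)
  | next f hf => intro i h; exact hf _ h.2
  | untl f g hf hg =>
    rintro i ⟨j, h1, _, h2, h3⟩
    exact ⟨j, h1, hg _ h2, fun n a b => hf _ (h3 n a b)⟩
  | rels f g hf hg =>
    rintro i ⟨j, h1, _, h2, h3⟩ m hm
    by_cases h : m ≤ j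
    · exact Or.inl (hg _ (h3 m hm h))
    · exact Or.inr ⟨j, h1, by omega, hf _ h2⟩
  | prev f hf => intro i h; exact ⟨h.1, hf _ h.2⟩
  | wprev f hf => intro i h; exact h.imp id (hf _)
  | since f g hf hg =>
    rintro i ⟨j, h1, h2, h3⟩
    exact ⟨j, h1, hg _ h2, fun n a b => hf _ (h3 n a b)⟩
  | trig f g hf hg =>
    intro i h j hj
    exact (h j hj).imp (hg _) (fun ⟨n, a, b, c⟩ => ⟨n, a, b, hf _ c⟩)

/-- Subformulas. -/
def subf {AP : Type} : PLTL AP → Set (PLTL AP)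
  | .atom p => {.atom p}
  | .natom p => {.natom p}
  | .conj f g => insert (.conj f g) (subf f ∪ subf g)
  | .disj f g => insert (.disj f g) (subf f ∪ subf g)
  | .next f => insert (.next f) (subf f)
  | .untl f g => insert (.untl f g) (subf f ∪ subf g)
  | .rels f g => insert (.rels f g) (subf f ∪ subf g)
  | .prev f => insert (.prev f) (subf f)
  | .wprev f => insert (.wprev f) (subf f)
  | .since f g => insert (.since f g) (subf f ∪ subf g)
  | .trig f g => insert (.trig f g) (subf f ∪ subf g)

theorem subf_finite {AP : Type} (f : PLTL AP) : (subf f).Finite := by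
  induction f <;> simp_all [subf, Set.Finite.insert, Set.Finite.union]

theorem subf_self {AP : Type} (f : PLTL AP) : f ∈ subf f := by
  cases f <;> simp [subf]

theorem lasso {C : Type} [Finite C] (τ : ℕ → C) :
    ∃ a b, a < b ∧ τ a = τ b ∧ ∀ n, a ≤ n → ∃ j, a ≤ j ∧ j < b ∧ τ j = τ n := by
  obtain ⟨c, hc⟩ := Finite.exists_infinite_fiber τ
  have hc' : (τ ⁻¹' {c}).Infinite := Set.infinite_coe_iff.mp hc
  obtain ⟨a, ha⟩ := hc'.nonempty
  have hw : ∀ d : C, ∃ N, ∀ n, a ≤ n → τ n = d → ∃ j, a ≤ j ∧ j < N ∧ τ j = d := by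
    intro d
    by_cases h : ∃ n, a ≤ n ∧ τ n = d
    · obtain ⟨n, h1, h2⟩ := h
      exact ⟨n + 1, fun _ _ _ => ⟨n, h1, by omega, h2⟩⟩
    · exact ⟨0, fun n h1 h2 => absurd ⟨n, h1, h2⟩ h⟩
  choose N hN using hw
  obtain ⟨B, hB⟩ := (Set.finite_range N).bddAbove
  obtain ⟨b, hb, hab⟩ := hc'.exists_gt (max a B)
  refine ⟨a, b, by omega, ?_, fun n hn => ?_⟩
  · rw [Set.mem_preimage, Set.mem_singleton_iff] at ha hb
    rw [ha, hb]
  · obtain ⟨j, h1, h2, h3⟩ := hN (τ n) n hn rfl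
    have := hB ⟨τ n, rfl⟩
    exact ⟨j, h1, by omega, h3⟩

/-- Abstract until. -/
def UU (p q : ℕ → Prop) (i : ℕ) : Prop :=
  ∃ j, i ≤ j ∧ q j ∧ ∀ n, i ≤ n → n < j → p n

/-- Abstract since. -/
def SS (p q : ℕ → Prop) (i : ℕ) : Prop :=
  ∃ j, j ≤ i ∧ q j ∧ ∀ n, j < n → n ≤ i → p n

theorem UU_unfold (p q : ℕ → Prop) (i : ℕ) : UU p q i ↔ q i ∨ (p i ∧ UU p q (i + 1)) := by
  constructor
  · rintro ⟨j, h1, h2, h3⟩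
    by_cases h : j = i
    · subst h; exact Or.inl h2
    · exact Or.inr ⟨h3 i le_rfl (by omega), j, by omega, h2, fun n a b => h3 n (by omega) b⟩
  · rintro (h | ⟨h, j, h1, h2, h3⟩)
    · exact ⟨i, le_rfl, h, fun n a b => by omega⟩
    · refine ⟨j, by omega, h2, fun n a b => ?_⟩
      by_cases e : n = i
      · subst e; exact h
      · exact h3 n (by omega) b

theorem SS_zero (p q : ℕ → Prop) : SS p q 0 ↔ q 0 := by
  constructor
  · rintro ⟨j, h1, h2, h3⟩
    obtain rfl : j = 0 := by omega
    exact h2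
  · intro h
    exact ⟨0, le_rfl, h, fun n a b => by omega⟩

theorem SS_succ (p q : ℕ → Prop) (i : ℕ) :
    SS p q (i + 1) ↔ q (i + 1) ∨ (p (i + 1) ∧ SS p q i) := by
  constructor
  · rintro ⟨j, h1, h2, h3⟩
    by_cases h : j = i + 1
    · subst h; exact Or.inl h2
    · exact Or.inr ⟨h3 (i+1) (by omega) le_rfl, j, by omega, h2, fun n a b => h3 n a (by omega)⟩
  · rintro (h | ⟨h, j, h1, h2, h3⟩)
    · exact ⟨i + 1, le_rfl, h, fun n a b => by omega⟩
    · refine ⟨j, by omega, h2, fun n a b => ?_⟩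
      by_cases e : n = i + 1
      · subst e; exact h
      · exact h3 n a (by omega)

theorem UU_map {C : Type} (τ : ℕ → C) (h : ℕ → ℕ)
    (H1 : ∀ i, τ (h (i + 1)) = τ (h i + 1))
    (H2 : ∀ i n, h i ≤ n → ∃ j, i ≤ j ∧ τ (h j) = τ n)
    (p q : ℕ → Prop) (hq : ∀ m n, τ m = τ n → (q m ↔ q n))
    (hu : ∀ m n, τ m = τ n → (UU p q m ↔ UU p q n)) (i : ℕ) :
    UU (fun n => p (h n)) (fun n => q (h n)) i ↔ UU p q (h i) := by
  constructor
  · rintro ⟨j, h1, h2, h3⟩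
    obtain ⟨d, rfl⟩ := Nat.exists_eq_add_of_le h1
    clear h1
    induction d generalizing i with
    | zero => exact (UU_unfold _ _ _).2 (Or.inl h2)
    | succ d ih =>
      refine (UU_unfold _ _ _).2 (Or.inr ⟨h3 i le_rfl (by omega), ?_⟩)
      rw [← hu _ _ (H1 i)]
      refine ih (i + 1) ?_ (fun n a b => h3 n (by omega) (by omega))
      rwa [show i + 1 + d = i + (d + 1) by omega]
  · intro hi
    by_contra hc
    have key : ∀ d, UU p q (h (i + d)) ∧ ¬ UU (fun n => p (h n)) (fun n => q (h n)) (i + d) := by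
      intro d
      induction d with
      | zero => exact ⟨hi, hc⟩
      | succ d ih =>
        obtain ⟨h1, h2⟩ := ih
        rw [UU_unfold] at h1 h2
        rw [← hu _ _ (H1 _)] at h1
        rw [← add_assoc]
        tauto
    obtain ⟨n, h1, h2, -⟩ := hi
    obtain ⟨j, h3, h4⟩ := H2 i n h1
    obtain ⟨d, rfl⟩ := Nat.exists_eq_add_of_le h3
    exact (key d).2 ((UU_unfold _ _ _).2 (Or.inl ((hq _ _ h4).2 h2)))

theorem SS_map {C : Type} (τ : ℕ → C) (h : ℕ → ℕ) (H0 : h 0 = 0)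
    (H1 : ∀ i, τ (h (i + 1)) = τ (h i + 1))
    (p q : ℕ → Prop) (hp : ∀ m n, τ m = τ n → (p m ↔ p n))
    (hq : ∀ m n, τ m = τ n → (q m ↔ q n))
    (hu : ∀ m n, τ m = τ n → (SS p q m ↔ SS p q n)) (i : ℕ) :
    SS (fun n => p (h n)) (fun n => q (h n)) i ↔ SS p q (h i) := by
  induction i with
  | zero => rw [H0, SS_zero, SS_zero, H0]
  | succ i ih =>
    rw [SS_succ, hu _ _ (H1 i), SS_succ, ih, hp _ _ (H1 i), hq _ _ (H1 i)]

section
variable {AP S : Type} (L : S → Set AP) (π : ℕ → S)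

theorem sat_untl (f g : PLTL AP) (i : ℕ) :
    PLTL.sat L π (.untl f g) i ↔ UU (PLTL.sat L π f) (PLTL.sat L π g) i := Iff.rfl

theorem sat_since (f g : PLTL AP) (i : ℕ) :
    PLTL.sat L π (.since f g) i ↔ SS (PLTL.sat L π f) (PLTL.sat L π g) i := Iff.rfl

theorem sat_rels (f g : PLTL AP) (i : ℕ) : PLTL.sat L π (.rels f g) i ↔
    ¬ UU (fun n => ¬ PLTL.sat L π f n) (fun n => ¬ PLTL.sat L π g n) i := by
  simp only [PLTL.sat, UU]
  push Not
  exact forall₂_congr fun j _ => or_iff_not_imp_left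

theorem sat_trig (f g : PLTL AP) (i : ℕ) : PLTL.sat L π (.trig f g) i ↔
    ¬ SS (fun n => ¬ PLTL.sat L π f n) (fun n => ¬ PLTL.sat L π g n) i := by
  simp only [PLTL.sat, SS]
  push Not
  exact forall₂_congr fun j _ => or_iff_not_imp_left

theorem sat_map {C : Type} (τ : ℕ → C) (h : ℕ → ℕ) (A : Set (PLTL AP)) (H0 : h 0 = 0)
    (H1 : ∀ i, τ (h (i + 1)) = τ (h i + 1))
    (H2 : ∀ i n, h i ≤ n → ∃ j, i ≤ j ∧ τ (h j) = τ n)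
    (hA : ∀ f ∈ A, ∀ m n, τ m = τ n → (PLTL.sat L π f m ↔ PLTL.sat L π f n))
    (f : PLTL AP) : subf f ⊆ A →
    ∀ i, PLTL.sat L (fun n => π (h n)) f i ↔ PLTL.sat L π f (h i) := by
  induction f with
  | atom p => intro _ i; exact Iff.rfl
  | natom p => intro _ i; exact Iff.rfl
  | conj f g hf hg =>
    intro hs i
    simp only [subf, Set.insert_subset_iff, Set.union_subset_iff] at hs
    exact and_congr (hf hs.2.1 i) (hg hs.2.2 i)
  | disj f g hf hg =>
    intro hs i
    simp only [subf, Set.insert_subset_iff, Set.union_subset_iff] at hs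
    exact or_congr (hf hs.2.1 i) (hg hs.2.2 i)
  | next f hf =>
    intro hs i
    simp only [subf, Set.insert_subset_iff] at hs
    exact (hf hs.2 (i+1)).trans (hA f (hs.2 (subf_self f)) _ _ (H1 i))
  | untl f g hf hg =>
    intro hs i
    simp only [subf, Set.insert_subset_iff, Set.union_subset_iff] at hs
    rw [sat_untl, funext fun n => propext (hf hs.2.1 n), funext fun n => propext (hg hs.2.2 n)]
    exact UU_map τ h H1 H2 _ _ (hA g (hs.2.2 (subf_self g))) (hA _ hs.1) i
  | rels f g hf hg =>
    intro hs i
    simp only [subf, Set.insert_subset_iff, Set.union_subset_iff] at hs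
    rw [sat_rels, sat_rels, funext fun n => propext (hf hs.2.1 n),
      funext fun n => propext (hg hs.2.2 n)]
    refine not_congr (UU_map τ h H1 H2 (fun n => ¬ PLTL.sat L π f n)
      (fun n => ¬ PLTL.sat L π g n)
      (fun m n e => not_congr (hA g (hs.2.2 (subf_self g)) m n e)) (fun m n e => ?_) i)
    have := hA _ hs.1 m n e
    rw [sat_rels, sat_rels] at this
    exact not_iff_not.1 this
  | prev f hf =>
    intro hs i
    simp only [subf, Set.insert_subset_iff] at hs
    cases i with
    | zero => rw [H0]; simp [PLTL.sat]
    | succ i =>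
      rw [hA _ hs.1 _ _ (H1 i)]
      simpa [PLTL.sat] using hf hs.2 i
  | wprev f hf =>
    intro hs i
    simp only [subf, Set.insert_subset_iff] at hs
    cases i with
    | zero => rw [H0]; simp [PLTL.sat]
    | succ i =>
      rw [hA _ hs.1 _ _ (H1 i)]
      simpa [PLTL.sat] using hf hs.2 i
  | since f g hf hg =>
    intro hs i
    simp only [subf, Set.insert_subset_iff, Set.union_subset_iff] at hs
    rw [sat_since, funext fun n => propext (hf hs.2.1 n), funext fun n => propext (hg hs.2.2 n)]
    exact SS_map τ h H0 H1 _ _ (hA f (hs.2.1 (subf_self f))) (hA g (hs.2.2 (subf_self g)))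
      (hA _ hs.1) i
  | trig f g hf hg =>
    intro hs i
    simp only [subf, Set.insert_subset_iff, Set.union_subset_iff] at hs
    rw [sat_trig, sat_trig, funext fun n => propext (hf hs.2.1 n),
      funext fun n => propext (hg hs.2.2 n)]
    refine not_congr (SS_map τ h H0 H1 (fun n => ¬ PLTL.sat L π f n)
      (fun n => ¬ PLTL.sat L π g n)
      (fun m n e => not_congr (hA f (hs.2.1 (subf_self f)) m n e))
      (fun m n e => not_congr (hA g (hs.2.2 (subf_self g)) m n e)) (fun m n e => ?_) i)
    have := hA _ hs.1 m n e
    rw [sat_trig, sat_trig] at this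
    exact not_iff_not.1 this
end

/-- The folding map: positions from `a` on are reduced into `[a, b)`. -/
def fold (a b i : ℕ) : ℕ := if i < a then i else a + (i - a) % (b - a)

theorem fold_succ (a b i : ℕ) (hab : a < b) :
    fold a b (i + 1) = fold a b i + 1 ∨ (fold a b (i + 1) = a ∧ fold a b i + 1 = b) := by
  unfold fold
  by_cases h : i + 1 < a
  · left; rw [if_pos h, if_pos (by omega)]
  by_cases h' : i < a
  · left
    rw [if_neg h, if_pos h', show i + 1 - a = 0 by omega, Nat.zero_mod]; omega
  rw [if_neg h, if_neg h', show i + 1 - a = (i - a) + 1 by omega]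
  have hlt := Nat.mod_lt (i - a) (show b - a > 0 by omega)
  by_cases e : (i - a) % (b - a) + 1 = b - a
  · right
    have : ((i - a) + 1) % (b - a) = 0 := by
      rw [← Nat.mod_add_mod, e, Nat.mod_self]
    omega
  · left
    have : ((i - a) + 1) % (b - a) = (i - a) % (b - a) + 1 := by
      rw [← Nat.mod_add_mod, Nat.mod_eq_of_lt]; omega
    omega

theorem exists_loop {AP S : Type} [Finite S] (M : Kripke S AP) (ψ : PLTL AP) (π : ℕ → S)
    (hπ : M.InitPath π) (hs : PLTL.sat M.L π ψ 0) :
    ∃ (π' : ℕ → S) (k l : ℕ), M.InitPath π' ∧ IsKLoop π' k l ∧ PLTL.sat M.L π' ψ 0 := by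
  haveI : Finite (subf ψ) := subf_finite ψ
  let τ : ℕ → S × (subf ψ → Prop) := fun i => (π i, fun f => PLTL.sat M.L π f.1 i)
  obtain ⟨a, b, hab, hτ, hw⟩ := lasso τ
  have H0 : fold a b 0 = 0 := by
    unfold fold; split_ifs with h
    · rfl
    · simp; omega
  have H1 : ∀ i, τ (fold a b (i + 1)) = τ (fold a b i + 1) := by
    intro i
    rcases fold_succ a b i hab with h | ⟨h1, h2⟩
    · rw [h]
    · rw [h1, h2, hτ]
  have hper : ∀ i, a ≤ i → fold a b (i + (b - a)) = fold a b i := by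
    intro i hi
    unfold fold
    rw [if_neg (by omega), if_neg (by omega), show i + (b - a) - a = (i - a) + (b - a) by omega,
      Nat.add_mod_right]
  have H2 : ∀ i n, fold a b i ≤ n → ∃ j, i ≤ j ∧ τ (fold a b j) = τ n := by
    intro i n hn
    by_cases hna : n < a
    · refine ⟨n, ?_, by rw [fold, if_pos hna]⟩
      by_contra hc
      unfold fold at hn
      split_ifs at hn <;> omega
    · obtain ⟨j, h1, h2, h3⟩ := hw n (by omega)
      refine ⟨j + i * (b - a), ?_, ?_⟩
      · have : i * 1 ≤ i * (b - a) := Nat.mul_le_mul_left i (by omega)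
        omega
      · rw [← h3, fold, if_neg (by omega), show j + i * (b - a) - a = (j - a) + i * (b - a) by omega,
          Nat.add_mul_mod_self_right, Nat.mod_eq_of_lt (by omega)]
        congr 1; omega
  have hA : ∀ f ∈ subf ψ, ∀ m n, τ m = τ n →
      (PLTL.sat M.L π f m ↔ PLTL.sat M.L π f n) := by
    intro f hf m n e
    exact iff_of_eq (congrFun (congrArg Prod.snd e) ⟨f, hf⟩)
  refine ⟨fun n => π (fold a b n), b, a + 1, ⟨?_, fun i => ?_⟩, ⟨by omega, by omega, ?_, ?_⟩, ?_⟩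
  · show M.I (π (fold a b 0))
    rw [H0]; exact hπ.1
  · have : π (fold a b (i + 1)) = π (fold a b i + 1) := congrArg Prod.fst (H1 i)
    show M.T (π (fold a b i)) (π (fold a b (i + 1)))
    rw [this]; exact hπ.2 _
  · have := hper a le_rfl
    rw [show a + (b - a) = b by omega] at this
    show π (fold a b (a + 1 - 1)) = π (fold a b b)
    rw [this, Nat.add_sub_cancel]
  · intro i hi
    show π (fold a b (i + (b + 1 - (a + 1)))) = π (fold a b i)
    rw [show b + 1 - (a + 1) = b - a by omega, hper i (by omega)]
  · rw [sat_map M.L π τ (fold a b) (subf ψ) H0 H1 H2 hA ψ subset_rfl, H0]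
    exact hs

theorem bsat_sat {AP S : Type} (L : S → Set AP) (π : ℕ → S) (k : ℕ) (f : PLTL AP)
    (h : PLTL.bsat L π k f) : PLTL.sat L π f 0 := by
  rcases h with ⟨_, _, h⟩ | h
  · exact h
  · exact satNL_sat L π k f 0 h

end BMC

open BMC in
/-- The bounded PLTL semantics is eventually complete on finite models: there
is a bound `k` such that `M` has an initialised path satisfying `ψ` iff it
has an initialised path satisfying `ψ` in the bounded semantics at `k`.
Moreover, for every (k,l)-loop `π` the bounded semantics coincides with the
standard semantics: `π ⊨_k ψ ↔ π ⊨ ψ`. -/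
theorem bounded_semantics_eventually_complete {S AP : Type} [Finite S]
    (M : Kripke S AP) (hTot : M.Total) (ψ : PLTL AP) :
    (∃ k : ℕ,
      (∃ π : ℕ → S, M.InitPath π ∧ PLTL.sat M.L π ψ 0) ↔
      (∃ π' : ℕ → S, M.InitPath π' ∧ PLTL.bsat M.L π' k ψ)) ∧
    (∀ (π : ℕ → S) (k l : ℕ), IsKLoop π k l →
      (PLTL.bsat M.L π k ψ ↔ PLTL.sat M.L π ψ 0)) := by
  refine ⟨?_, fun π k l hl => ⟨bsat_sat _ _ _ _, fun h => Or.inl ⟨l, hl, h⟩⟩⟩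
  by_cases h : ∃ π : ℕ → S, M.InitPath π ∧ PLTL.sat M.L π ψ 0
  · obtain ⟨π, hπ, hs⟩ := h
    obtain ⟨π', k, l, h1, h2, h3⟩ := exists_loop M ψ π hπ hs
    exact ⟨k, fun _ => ⟨π', h1, Or.inl ⟨l, h2, h3⟩⟩, fun _ => ⟨π, hπ, hs⟩⟩
  · exact ⟨0, fun h' => absurd h' h, fun ⟨π, hπ, hb⟩ => ⟨π, hπ, bsat_sat _ _ _ _ hb⟩⟩
end
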